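/- arXiv:0810.5559 — 2 statements merged into one kernel-verified Lean document; each statement's English description precedes it below -/
import Mathlib

section
/- Let f : S² → S² be a continuous map, let x ∈ S² and y = f(x). Suppose there exist open, connected, simply connected subsets U ∋ x and V ∋ y of S² such that f maps U ∖ {x} into V ∖ {y} and the restriction of f to U ∖ {x} is a covering map onto V ∖ {y}, all of whose fibers have exactly k elements (k a positive integer). Then f is a ramified covering of local degree k at x. -/
open Set Filter Topology

noncomputable section

abbrev Sph : Type := Metric.sphere (0 : EuclideanSpace ℝ (Fin 3)) 1

/-- The open unit disk in ℂ. -/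
def unitDisk : Set ℂ := Metric.ball 0 1

/-- `f` is a ramified covering of local degree `k` at `x`: in suitable local homeomorphic
coordinates identifying neighborhoods of `x` and `f x` with the unit disk (sending `x` and
`f x` to `0`), the map `f` becomes `z ↦ z ^ k`. -/
def IsRamifiedAt (f : Sph → Sph) (x : Sph) (k : ℕ) : Prop :=
  0 < k ∧ ∃ (U V : Set Sph) (hx : x ∈ U) (hfx : f x ∈ V) (hmap : Set.MapsTo f U V),
    IsOpen U ∧ IsOpen V ∧
      ∃ (φ : U ≃ₜ unitDisk) (ψ : V ≃ₜ unitDisk),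
        (φ ⟨x, hx⟩ : ℂ) = 0 ∧ (ψ ⟨f x, hfx⟩ : ℂ) = 0 ∧
          ∀ z : U, (ψ ⟨f z, hmap z.2⟩ : ℂ) = (φ z : ℂ) ^ k

/-- `f` is a ramified covering: a continuous map that is a ramified covering of some local
degree at every point. -/
def IsRamifiedCovering (f : Sph → Sph) : Prop :=
  Continuous f ∧ ∀ x : Sph, ∃ k : ℕ, IsRamifiedAt f x k

/-- A critical point of `f` is a point of local degree at least 2. -/
def IsCriticalPt (f : Sph → Sph) (x : Sph) : Prop := ∃ k, 2 ≤ k ∧ IsRamifiedAt f x k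

/-- A critical value of `f` is the image of a critical point. -/
def IsCriticalValue (f : Sph → Sph) (y : Sph) : Prop := ∃ x, IsCriticalPt f x ∧ f x = y

namespace RMT
open Metric Function
open scoped Pointwise ComplexConjugate

theorem step1 {U : Set ℂ} (hUo : IsOpen U)
    (hUc : IsSimplyConnected U) (hU : U ≠ univ) :
    ∃ f : ℂ → ℂ, Injective f ∧ ¬Dense (f '' U) ∧ ∀ z ∈ U, deriv f z ≠ 0 := by
  wlog hU₀ : 0 ∉ U
  · rw [ne_univ_iff_exists_notMem] at hU
    rcases hU with ⟨a, ha⟩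
    specialize this (hUo.vadd (-a)) (by simpa) (by
      intro h
      have : (0 : ℂ) ∈ -a +ᵥ U := by rw [h]; trivial
      rw [mem_vadd_set_iff_neg_vadd_mem] at this
      simp at this; exact ha this)
      (by simpa [mem_vadd_set_iff_neg_vadd_mem])
    rcases this with ⟨f, hf_inj, hf_dense, hdf⟩
    refine ⟨f ∘ (-a + ·), hf_inj.comp (add_right_injective (-a)), ?_, fun z hz ↦ ?_⟩
    · simpa only [← image_vadd, Set.image_image] using! hf_dense
    · simpa [Function.comp_def, deriv_comp_const_add] using hdf (-a + z) (mapsTo_image _ _ hz)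
  rcases Complex.exists_continuousOn_pow_eq hUc hUo continuousOn_id (by rwa [image_id]) two_ne_zero
    with ⟨f, hfc, hf_inv⟩
  replace hf_inv : LeftInverse (· ^ 2) f := hf_inv
  have hf₀ : ∀ z ∈ U, f z ≠ 0 := by
    intro z hz hfz
    simpa [hfz, (ne_of_mem_of_not_mem hz hU₀).symm] using hf_inv z
  have hdf : ∀ z ∈ U, HasStrictDerivAt f (2 * f z)⁻¹ z := by
    intro z hz
    apply HasStrictDerivAt.of_local_left_inverse
    · exact hfc.continuousAt <| hUo.mem_nhds hz
    · simpa using hasStrictDerivAt_pow 2 (f z)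
    · simpa using hf₀ z hz
    · exact .of_forall hf_inv
  refine ⟨f, hf_inv.injective, ?_, fun z hz ↦ ?_⟩
  · simp only [Dense, not_forall, mem_closure_iff_frequently, not_frequently]
    rcases hUc.nonempty with ⟨x, hx⟩
    use -f x
    have : f '' U ∈ 𝓝 (f x) := by
      rw [← (hdf x hx).map_nhds_eq (by simpa using hf₀ x hx)]
      exact Filter.image_mem_map <| hUo.mem_nhds hx
    rw [nhds_neg, eventually_neg]
    filter_upwards [this]
    rintro _ ⟨a, ha, rfl⟩ ⟨b, hb, hab⟩
    obtain rfl : a = b := by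
      rw [← hf_inv b, hab]
      simp [hf_inv a]
    refine hf₀ a ha ?_
    linear_combination hab / 2
  · simpa [(hdf z hz).hasDerivAt.deriv] using hf₀ z hz

lemma step2 {U : Set ℂ} (hUo : IsOpen U)
    (hUc : IsSimplyConnected U) (hU : U ≠ univ) :
    ∃ f : ℂ → ℂ, MapsTo f U (ball 0 1) ∧ InjOn f U ∧ ∀ z ∈ U, deriv f z ≠ 0 := by
  rcases step1 hUo hUc hU with ⟨f, hf_inj, hfd, hdf⟩
  obtain ⟨x, ε, hε₀, hε⟩ : ∃ (x : ℂ) (ε : ℝ), 0 < ε ∧ ∀ a ∈ U, ε < dist (f a) x := by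
    simpa [Dense, mem_closure_iff_nhds_basis Metric.nhds_basis_closedBall] using hfd
  have hfx : ∀ z ∈ U, f z ≠ x := fun z hz ↦ by simpa using hε₀.trans (hε z hz)
  use fun z ↦ ε / (f z - x)
  refine ⟨?mapsTo, ?injOn, ?deriv⟩
  case mapsTo =>
    intro z hz
    rw [mem_ball_zero_iff, norm_div, Complex.norm_real, Real.norm_of_nonneg hε₀.le, div_lt_one₀]
    · simpa [dist_eq_norm] using hε z hz
    · simpa [sub_eq_zero] using hfx z hz
  case injOn =>
    intro z hz w hw heq
    simpa [div_eq_mul_inv, hε₀.ne', hf_inj.eq_iff] using heq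
  case deriv =>
    intro z hz
    have hdz : DifferentiableAt ℂ f z := differentiableAt_of_deriv_ne_zero (hdf z hz)
    have hne : f z - x ≠ 0 := sub_ne_zero.2 (hfx z hz)
    have h := ((hasDerivAt_const z (ε : ℂ)).div (hdz.hasDerivAt.sub_const x) hne).deriv
    have h' : deriv (fun z ↦ (ε : ℂ) / (f z - x)) z =
      (0 * (f z - x) - ε * deriv f z) / (f z - x) ^ 2 := h
    rw [h']
    have : (ε : ℂ) ≠ 0 := by exact_mod_cast hε₀.ne'
    have h3 := hdf z hz
    simp [hne, this, h3]

/-- Disk automorphism. -/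
def mob (w z : ℂ) : ℂ := (z - w) / (1 - conj w * z)

lemma mob_den {w z : ℂ} (hw : ‖w‖ < 1) (hz : ‖z‖ < 1) : 1 - conj w * z ≠ 0 := by
  intro h
  have h1 : conj w * z = 1 := (sub_eq_zero.1 h).symm
  have h2 : ‖w‖ * ‖z‖ = 1 := by
    have := congrArg norm h1
    simpa using this
  nlinarith [norm_nonneg w, norm_nonneg z]

lemma mob_mem {w z : ℂ} (hw : ‖w‖ < 1) (hz : ‖z‖ < 1) : ‖mob w z‖ < 1 := by
  have hd := mob_den hw hz
  have hd' : 0 < ‖1 - conj w * z‖ := norm_pos_iff.2 hd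
  rw [mob, norm_div, div_lt_one hd']
  apply lt_of_pow_lt_pow_left₀ 2 hd'.le
  rw [← Complex.normSq_eq_norm_sq, ← Complex.normSq_eq_norm_sq]
  have h1 : Complex.normSq w < 1 := by rw [Complex.normSq_eq_norm_sq]; nlinarith [norm_nonneg w]
  have h2 : Complex.normSq z < 1 := by rw [Complex.normSq_eq_norm_sq]; nlinarith [norm_nonneg z]
  have : Complex.normSq (1 - conj w * z) - Complex.normSq (z - w) =
    (1 - Complex.normSq w) * (1 - Complex.normSq z) := by
    simp [Complex.normSq_apply]; ring
  nlinarith [mul_pos (sub_pos.2 h1) (sub_pos.2 h2)]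

lemma mob_hasDeriv {w z : ℂ} (hw : ‖w‖ < 1) (hz : ‖z‖ < 1) :
    HasDerivAt (mob w) ((1 - conj w * w) / (1 - conj w * z) ^ 2) z := by
  have hd := mob_den hw hz
  have h := ((hasDerivAt_id z).sub_const w).div
    (((hasDerivAt_id z).const_mul (conj w)).const_sub 1) hd
  have h2 : HasDerivAt (mob w) _ z := h
  convert h2 using 1
  simp
  congr 1
  ring

lemma mob_inj {w z z' : ℂ} (hw : ‖w‖ < 1) (hz : ‖z‖ < 1) (hz' : ‖z'‖ < 1)
    (h : mob w z = mob w z') : z = z' := by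
  have hd := mob_den hw hz
  have hd' := mob_den hw hz'
  rw [mob, mob, div_eq_div_iff hd hd'] at h
  have h3 : (z - z') * (1 - conj w * w) = 0 := by linear_combination h
  rcases mul_eq_zero.1 h3 with h4 | h4
  · exact sub_eq_zero.1 h4
  · exact absurd h4 (mob_den hw hw)

/-- Injective holomorphic maps to the disk, normalized at `a`. -/
def Fam (Ω : Set ℂ) (a : ℂ) (g : ℂ → ℂ) : Prop :=
  DifferentiableOn ℂ g Ω ∧ InjOn g Ω ∧ MapsTo g Ω (ball 0 1) ∧ g a = 0

lemma fam_comp {Ω : Set ℂ} (hΩ : IsOpen Ω) {a : ℂ} (ha : a ∈ Ω) {g : ℂ → ℂ}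
    (hd : DifferentiableOn ℂ g Ω) (hi : InjOn g Ω) (hm : MapsTo g Ω (ball 0 1)) :
    Fam Ω a (mob (g a) ∘ g) ∧
      deriv (mob (g a) ∘ g) a = deriv g a / (1 - conj (g a) * g a) := by
  have hm' : ∀ z ∈ Ω, ‖g z‖ < 1 := fun z hz => by simpa using hm hz
  have hga := hm' a ha
  refine ⟨⟨?_, ?_, ?_, ?_⟩, ?_⟩
  · intro z hz
    exact (mob_hasDeriv hga (hm' z hz)).differentiableAt.comp_differentiableWithinAt z (hd z hz)
  · intro z hz z' hz' h
    exact hi hz hz' (mob_inj hga (hm' z hz) (hm' z' hz') h)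
  · intro z hz
    simpa using mob_mem hga (hm' z hz)
  · simp [mob]
  · have h1 := (hd.differentiableAt (hΩ.mem_nhds ha)).hasDerivAt
    have := ((mob_hasDeriv hga hga).comp a h1).deriv
    rw [this]
    have := mob_den hga hga
    field_simp

lemma fam_nonempty {Ω : Set ℂ} (hΩ : IsOpen Ω) (hs : IsSimplyConnected Ω) (hne : Ω ≠ univ)
    {a : ℂ} (ha : a ∈ Ω) : ∃ g, Fam Ω a g ∧ deriv g a ≠ 0 := by
  obtain ⟨f, hm, hi, hd⟩ := step2 hΩ hs hne
  have hm' : ∀ z ∈ Ω, ‖f z‖ < 1 := fun z hz => by simpa using hm hz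
  obtain ⟨h1, h2⟩ := fam_comp hΩ ha
    (fun z hz => (differentiableAt_of_deriv_ne_zero (hd z hz)).differentiableWithinAt) hi hm
  exact ⟨_, h1, by rw [h2]; exact div_ne_zero (hd a ha) (mob_den (hm' a ha) (hm' a ha))⟩

lemma lim_lu {Ω : Set ℂ} (hΩ : IsOpen Ω) {ι : Type*} {l : Filter ι} [l.NeBot] {G : ι → ℂ → ℂ}
    {g : ℂ → ℂ} (hd : ∀ n, DifferentiableOn ℂ (G n) Ω) (hm : ∀ n, MapsTo (G n) Ω (ball 0 1))
    (hl : ∀ z ∈ Ω, Tendsto (fun n => G n z) l (𝓝 (g z))) :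
    TendstoLocallyUniformlyOn G g l Ω := by
  rw [Metric.tendstoLocallyUniformlyOn_iff]
  intro ε hε c hc
  obtain ⟨r, hr, hrΩ⟩ := Metric.isOpen_iff.1 hΩ c hc
  set δ := min r (ε * r / 8) with hδ
  have hδ0 : 0 < δ := lt_min hr (by positivity)
  have key : ∀ n, ∀ z ∈ ball c δ, dist (G n z) (G n c) ≤ ε / 4 := by
    intro n z hz
    have hz1 : z ∈ ball c r := ball_subset_ball (min_le_left _ _) hz
    have := Complex.dist_le_div_mul_dist_of_mapsTo_ball (R₂ := 2) ((hd n).mono hrΩ) (fun w hw => by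
      have h1 := hm n (hrΩ hw)
      have h2 := hm n hc
      rw [mem_ball] at h1 h2
      rw [mem_closedBall]
      linarith [dist_triangle_right (G n w) (G n c) 0]) hz1
    refine this.trans ?_
    have h3 : dist z c ≤ ε * r / 8 := (le_of_lt hz).trans (min_le_right _ _)
    calc 2 / r * dist z c ≤ 2 / r * (ε * r / 8) := by gcongr
      _ = ε / 4 := by field_simp; norm_num
  refine ⟨ball c δ, mem_nhdsWithin_of_mem_nhds (ball_mem_nhds c hδ0), ?_⟩
  have hev := (Metric.tendsto_nhds.1 (hl c hc)) (ε / 4) (by positivity)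
  filter_upwards [hev] with n hn z hz
  have hzΩ : z ∈ Ω := hrΩ (ball_subset_ball (min_le_left _ _) hz)
  have hlim : dist (g z) (g c) ≤ ε / 4 :=
    le_of_tendsto ((hl z hzΩ).dist (hl c hc)) (Eventually.of_forall fun n => key n z hz)
  have h1 := key n z hz
  have h2 := dist_triangle4 (g z) (g c) (G n c) (G n z)
  rw [dist_comm (g c), dist_comm (G n c) (G n z)] at h2
  linarith

lemma hurwitz {Ω : Set ℂ} (hΩ : IsOpen Ω) (hc : IsPreconnected Ω) {ι : Type*} {l : Filter ι}
    [l.NeBot] {G : ι → ℂ → ℂ} {g : ℂ → ℂ} (hd : ∀ n, DifferentiableOn ℂ (G n) Ω)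
    (hi : ∀ n, InjOn (G n) Ω) (hl : TendstoLocallyUniformlyOn G g l Ω)
    {a : ℂ} (ha : a ∈ Ω) (hga : deriv g a ≠ 0) : InjOn g Ω := by
  have hgd : DifferentiableOn ℂ g Ω := hl.differentiableOn (Eventually.of_forall hd) hΩ
  have hga' : AnalyticOnNhd ℂ g Ω := hgd.analyticOnNhd hΩ
  intro z1 h1 z2 h2 h12
  by_contra hne
  have hiso : ∀ᶠ z in 𝓝[≠] z2, g z ≠ g z2 := by
    rcases (hga' z2 h2).eventually_eq_or_eventually_ne (analyticAt_const (v := g z2)) with h | h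
    · exfalso
      have := hga'.eqOn_of_preconnected_of_eventuallyEq
        (analyticOnNhd_const (v := g z2)) hc h2 h
      apply hga
      have h3 : g =ᶠ[𝓝 a] fun _ => g z2 := by
        filter_upwards [hΩ.mem_nhds ha] with z hz using this hz
      rw [h3.deriv_eq]; simp
    · exact h
  rw [eventually_nhdsWithin_iff] at hiso
  have hev : ∀ᶠ z in 𝓝 z2, (z ∈ ({z2}ᶜ : Set ℂ) → g z ≠ g z2) ∧ z ∈ Ω ∧ z ≠ z1 :=
    hiso.and ((hΩ.eventually_mem h2).and (isOpen_ne.eventually_mem (Ne.symm hne)))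
  obtain ⟨r, hr, hrs⟩ := nhds_basis_closedBall.mem_iff.1 hev
  have hsph : IsCompact (sphere z2 r) := isCompact_sphere _ _
  have hsc : ContinuousOn (fun z => ‖g z - g z2‖) (sphere z2 r) := by
    apply ContinuousOn.norm
    apply ContinuousOn.sub _ continuousOn_const
    exact hgd.continuousOn.mono fun z hz => (hrs (sphere_subset_closedBall hz)).2.1
  obtain ⟨w, hw, hmin⟩ := hsph.exists_isMinOn (NormedSpace.sphere_nonempty.2 hr.le) hsc
  set m := ‖g w - g z2‖ with hm
  have hm0 : 0 < m := by
    rw [hm, norm_pos_iff, sub_ne_zero]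
    exact (hrs (sphere_subset_closedBall hw)).1 (ne_of_mem_sphere hw hr.ne')
  have hcb : closedBall z2 r ⊆ Ω := fun z hz => (hrs hz).2.1
  have hu : TendstoUniformlyOn G g l (closedBall z2 r) :=
    (tendstoLocallyUniformlyOn_iff_forall_isCompact hΩ).1 hl _ hcb (isCompact_closedBall _ _)
  rw [Metric.tendstoUniformlyOn_iff] at hu
  have hz1 := (Metric.tendsto_nhds.1 (hl.tendsto_at h1)) (m / 8) (by positivity)
  obtain ⟨n, hn, hn1⟩ := ((hu (m / 8) (by positivity)).and hz1).exists
  have hz2 := hn z2 (mem_closedBall_self hr.le)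
  have hsub := (show DiffContOnCl ℂ (G n) (ball z2 r) from
    ((hd n).mono hcb).diffContOnCl_ball Subset.rfl).ball_subset_image_closedBall hr (ε := m / 2)
    (fun z hz => by
      have e1 := hn z (sphere_subset_closedBall hz)
      have e2 : m ≤ ‖g z - g z2‖ := hmin hz
      rw [← dist_eq_norm] at e2 ⊢
      have := dist_triangle4 (g z) (G n z) (G n z2) (g z2)
      rw [dist_comm (G n z2)] at this
      linarith)
    (by
      have : ∀ᶠ z in 𝓝[≠] z2, G n z ≠ G n z2 := by
        rw [eventually_nhdsWithin_iff]
        filter_upwards [hΩ.mem_nhds h2] with z hz hzne h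
        exact hzne (hi n hz h2 h)
      exact this.frequently.filter_mono nhdsWithin_le_nhds)
  have hmem : G n z1 ∈ ball (G n z2) (m / 2 / 2) := by
    rw [mem_ball]
    have := dist_triangle4 (G n z1) (g z1) (g z2) (G n z2)
    rw [h12, dist_self] at this
    rw [h12] at hn1
    linarith
  obtain ⟨u, hu1, hu2⟩ := hsub hmem
  exact (hrs hu1).2.2 (hi n (hcb hu1) h1 hu2)

lemma open_image {Ω : Set ℂ} (hΩ : IsOpen Ω) (hc : IsPreconnected Ω) {g : ℂ → ℂ} 
    (hd : DifferentiableOn ℂ g Ω) (hi : InjOn g Ω) {a : ℂ} (ha : a ∈ Ω) :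
    ∀ s ⊆ Ω, IsOpen s → IsOpen (g '' s) := by
  rcases (hd.analyticOnNhd hΩ).is_constant_or_isOpen hc with ⟨w, hw⟩ | h
  · exfalso
    have : ∀ᶠ z in 𝓝[≠] a, z ∈ Ω ∧ z ≠ a := 
      ((hΩ.eventually_mem ha).filter_mono nhdsWithin_le_nhds).and self_mem_nhdsWithin
    obtain ⟨z, hz, hza⟩ := this.exists
    exact hza (hi hz ha ((hw z hz).trans (hw a ha).symm))
  · exact h

lemma exists_max {Ω : Set ℂ} (hΩ : IsOpen Ω) (hs : IsSimplyConnected Ω) (hne : Ω ≠ univ)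
    {a : ℂ} (ha : a ∈ Ω) : ∃ g, Fam Ω a g ∧ deriv g a ≠ 0 ∧
      ∀ g', Fam Ω a g' → ‖deriv g' a‖ ≤ ‖deriv g a‖ := by
  have hc : IsPreconnected Ω := hs.isPathConnected.isConnected.isPreconnected
  set S : Set ℝ := {t | ∃ g, Fam Ω a g ∧ ‖deriv g a‖ = t} with hS
  obtain ⟨r, hr, hrΩ⟩ := Metric.isOpen_iff.1 hΩ a ha
  have hbd : BddAbove S := by
    refine ⟨1 / r, ?_⟩
    rintro _ ⟨g, ⟨h1, h2, h3, h4⟩, rfl⟩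
    refine Complex.norm_deriv_le_div_of_mapsTo_ball (h1.mono hrΩ) ?_ hr
    intro z hz
    rw [h4]
    exact ball_subset_closedBall (h3 (hrΩ hz))
  obtain ⟨g0, hg0, hg0'⟩ := fam_nonempty hΩ hs hne ha
  have hSn : S.Nonempty := ⟨_, g0, hg0, rfl⟩
  obtain ⟨u, -, hu, huS⟩ := exists_seq_tendsto_sSup hSn hbd
  choose G hG hGu using huS
  let l : Filter ℕ := ((Filter.hyperfilter ℕ : Ultrafilter ℕ) : Filter ℕ)
  have hl : l ≤ atTop := Nat.hyperfilter_le_atTop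
  have hlim : ∀ z, ∃ w, z ∈ Ω → w ∈ closedBall (0 : ℂ) 1 ∧ Tendsto (fun n => G n z) l (𝓝 w) := by
    intro z
    by_cases hz : z ∈ Ω
    · obtain ⟨w, hw, hw'⟩ := (isCompact_closedBall (0 : ℂ) 1).ultrafilter_le_nhds
        ((Filter.hyperfilter ℕ).map fun n => G n z) (by
          rw [le_principal_iff]
          exact Filter.mem_map.2 (Filter.univ_mem' fun n => ball_subset_closedBall ((hG n).2.2.1 hz)))
      exact ⟨w, fun _ => ⟨hw, hw'⟩⟩
    · exact ⟨0, fun h => absurd h hz⟩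
  choose g hg using hlim
  have hlu : TendstoLocallyUniformlyOn G g l Ω :=
    lim_lu hΩ (fun n => (hG n).1) (fun n => (hG n).2.2.1) (fun z hz => (hg z hz).2)
  have hgd : DifferentiableOn ℂ g Ω := hlu.differentiableOn (Eventually.of_forall fun n => (hG n).1) hΩ
  have hder := ((hlu.deriv (Eventually.of_forall fun n => (hG n).1) hΩ).tendsto_at ha).norm
  have hsup : ‖deriv g a‖ = sSup S := by
    refine tendsto_nhds_unique hder ((hu.mono_left hl).congr fun n => ?_)
    simp [hGu]
  have hmax : ∀ g', Fam Ω a g' → ‖deriv g' a‖ ≤ ‖deriv g a‖ := fun g' hg' => by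
    rw [hsup]; exact le_csSup hbd ⟨g', hg', rfl⟩
  have hne0 : deriv g a ≠ 0 := by
    rw [← norm_pos_iff]
    exact lt_of_lt_of_le (norm_pos_iff.2 hg0') (hmax _ hg0)
  have hinj : InjOn g Ω := hurwitz hΩ hc (fun n => (hG n).1) (fun n => (hG n).2.1) hlu ha hne0
  refine ⟨g, ⟨hgd, hinj, ?_, ?_⟩, hne0, hmax⟩
  · have ho := open_image hΩ hc hgd hinj ha Ω Subset.rfl hΩ
    have hsub : g '' Ω ⊆ closedBall 0 1 := by
      rintro _ ⟨z, hz, rfl⟩; exact (hg z hz).1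
    have := interior_maximal hsub ho
    rw [interior_closedBall _ one_ne_zero] at this
    exact fun z hz => this ⟨z, hz, rfl⟩
  · refine tendsto_nhds_unique (hg a ha).2 ?_
    simp [(hG _).2.2.2]

lemma sqrt_diff {h g : ℂ → ℂ} {z : ℂ} (hc : ContinuousAt h z) (h0 : h z ≠ 0)
    (hsq : ∀ x, h x ^ 2 = g x) (hg : DifferentiableAt ℂ g z) :
    HasDerivAt h (deriv g z / (2 * h z)) z := by
  have hst : HasStrictDerivAt (fun x : ℂ => x ^ 2) (2 * h z) (h z) := by
    simpa using hasStrictDerivAt_pow 2 (h z)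
  have hne : 2 * h z ≠ 0 := by simpa using h0
  have hli := hst.to_localInverse hne
  have hev : ∀ᶠ x in 𝓝 (h z), (hst.localInverse _ _ _ hne) (x ^ 2) = x :=
    HasStrictFDerivAt.eventually_left_inverse (hst.hasStrictFDerivAt_equiv hne)
  have h2 := hc.eventually hev
  have hcomp : HasDerivAt ((hst.localInverse _ _ _ hne) ∘ g) ((2 * h z)⁻¹ * deriv g z) z := by
    apply HasDerivAt.comp z _ hg.hasDerivAt
    rw [← hsq z]
    exact hli.hasDerivAt
  have h3 : h =ᶠ[𝓝 z] (hst.localInverse _ _ _ hne) ∘ g := by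
    filter_upwards [h2] with x hx
    rw [Function.comp_apply, ← hsq x, hx]
  rw [div_eq_inv_mul]
  exact hcomp.congr_of_eventuallyEq h3

lemma surj_of_max {Ω : Set ℂ} (hΩ : IsOpen Ω) (hs : IsSimplyConnected Ω)
    {a : ℂ} (ha : a ∈ Ω) {g : ℂ → ℂ} (hg : Fam Ω a g) (hd : deriv g a ≠ 0)
    (hmax : ∀ g', Fam Ω a g' → ‖deriv g' a‖ ≤ ‖deriv g a‖) : g '' Ω = ball 0 1 := by
  obtain ⟨h1, h2, h3, h4⟩ := hg
  have h3' : ∀ z ∈ Ω, ‖g z‖ < 1 := fun z hz => by simpa using h3 hz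
  apply Subset.antisymm h3.image_subset
  intro w hw
  by_contra hwn
  have hw1 : ‖w‖ < 1 := by simpa using hw
  set p : ℂ → ℂ := mob w ∘ g with hp
  have hpd : ∀ z ∈ Ω, DifferentiableAt ℂ p z := fun z hz =>
    (mob_hasDeriv hw1 (h3' z hz)).differentiableAt.comp z (h1.differentiableAt (hΩ.mem_nhds hz))
  have hpn : ∀ z ∈ Ω, ‖p z‖ < 1 := fun z hz => mob_mem hw1 (h3' z hz)
  have hp0 : ∀ z ∈ Ω, p z ≠ 0 := fun z hz h0 => by
    rw [hp, Function.comp_apply, mob, div_eq_zero_iff] at h0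
    rcases h0 with h0 | h0
    · exact hwn ⟨z, hz, sub_eq_zero.1 h0⟩
    · exact mob_den hw1 (h3' z hz) h0
  have hpi : InjOn p Ω := fun z hz z' hz' h => h2 hz hz' (mob_inj hw1 (h3' z hz) (h3' z' hz') h)
  obtain ⟨h, hhc, hsq⟩ := Complex.exists_continuousOn_pow_eq hs hΩ (g := p)
    (fun z hz => (hpd z hz).continuousAt.continuousWithinAt)
    (by rintro ⟨z, hz, h0⟩; exact hp0 z hz h0) two_ne_zero
  have hh0 : ∀ z ∈ Ω, h z ≠ 0 := fun z hz h0 => hp0 z hz (by rw [← hsq z, h0]; simp)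
  have hhd : ∀ z ∈ Ω, HasDerivAt h (deriv p z / (2 * h z)) z := fun z hz =>
    sqrt_diff (hhc.continuousAt (hΩ.mem_nhds hz)) (hh0 z hz) hsq (hpd z hz)
  have hhn : ∀ z ∈ Ω, ‖h z‖ < 1 := fun z hz => by
    have := hpn z hz
    rw [← hsq z, norm_pow] at this
    nlinarith [norm_nonneg (h z)]
  obtain ⟨hF, hFd⟩ := fam_comp hΩ ha (g := h)
    (fun z hz => (hhd z hz).differentiableAt.differentiableWithinAt)
    (fun z hz z' hz' e => hpi hz hz' (by rw [← hsq, ← hsq, e]))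
    (fun z hz => by simpa using hhn z hz)
  have hle := hmax _ hF
  rw [hFd, (hhd a ha).deriv] at hle
  have hpa : deriv p a = (1 - conj w * w) * deriv g a := by
    have := ((mob_hasDeriv hw1 (h3' a ha)).comp a
      (h1.differentiableAt (hΩ.mem_nhds ha)).hasDerivAt).deriv
    rw [hp, this, h4]; simp
  have hwa : h a ^ 2 = -w := by rw [hsq a, hp]; simp [mob, h4]
  have hs1 : ‖w‖ = ‖h a‖ ^ 2 := by rw [← norm_pow, hwa, norm_neg]
  set s := ‖h a‖ with hsdef
  have hs0 : 0 < s := norm_pos_iff.2 (hh0 a ha)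
  have hs1' : s < 1 := hhn a ha
  have hn : ∀ v : ℂ, ‖v‖ < 1 → ‖1 - conj v * v‖ = 1 - ‖v‖ ^ 2 := by
    intro v hv
    rw [Complex.conj_mul']
    rw [show (1 : ℂ) - (‖v‖ : ℂ) ^ 2 = ((1 - ‖v‖ ^ 2 : ℝ) : ℂ) by push_cast; ring,
      Complex.norm_real, Real.norm_of_nonneg]
    nlinarith [norm_nonneg v]
  rw [hpa, norm_div, norm_div, norm_mul, norm_mul, hn w hw1, hn (h a) (hhn a ha), hs1,
    ← hsdef] at hle
  have hg0 : 0 < ‖deriv g a‖ := norm_pos_iff.2 hd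
  have h5 : 0 < 1 - s ^ 2 := by nlinarith
  rw [div_div, div_le_iff₀ (by
    have : 0 < ‖(2 : ℂ)‖ := by norm_num
    positivity)] at hle
  have h6 : (1 - (s ^ 2) ^ 2) ≤ ‖(2 : ℂ)‖ * s * (1 - s ^ 2) := by
    by_contra hcon
    push Not at hcon
    nlinarith [mul_pos hg0 (sub_pos.2 hcon)]
  norm_num at h6
  nlinarith [mul_pos h5 (pow_pos (sub_pos.2 hs1') 2)]

theorem riemann {Ω : Set ℂ} (hΩ : IsOpen Ω) (hs : IsSimplyConnected Ω) {a : ℂ} (ha : a ∈ Ω) :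
    ∃ e : Ω ≃ₜ unitDisk, (e ⟨a, ha⟩ : ℂ) = 0 := by
  by_cases hne : Ω = univ
  · subst hne
    let e : (univ : Set ℂ) ≃ₜ unitDisk :=
      ((Homeomorph.Set.univ ℂ).trans (Homeomorph.subRight a)).trans Homeomorph.unitBall
    refine ⟨e, ?_⟩
    have h1 : e ⟨a, ha⟩ = Homeomorph.unitBall (a - a) := rfl
    rw [h1, sub_self, Homeomorph.coe_unitBall_apply_zero]
  · obtain ⟨g, hg, hd, hmax⟩ := exists_max hΩ hs hne ha
    have hsurj := surj_of_max hΩ hs ha hg hd hmax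
    have hop := open_image hΩ hs.isPathConnected.isConnected.isPreconnected hg.1 hg.2.1 ha
    let G : Ω → unitDisk := fun z => ⟨g z, hg.2.2.1 z.2⟩
    have hGc : Continuous G := by
      apply Continuous.subtype_mk
      exact continuousOn_iff_continuous_domRestrict.1 hg.1.continuousOn
    have hGb : Bijective G := by
      constructor
      · intro z z' h
        exact Subtype.ext (hg.2.1 z.2 z'.2 (congrArg Subtype.val h))
      · rintro ⟨w, hw⟩
        have hw' : w ∈ g '' Ω := by rw [hsurj]; exact hw
        obtain ⟨z, hz, rfl⟩ := hw'
        exact ⟨⟨z, hz⟩, rfl⟩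
    have hGo : IsOpenMap G := by
      intro s hs'
      have h1 : IsOpen (Subtype.val '' s) := hΩ.isOpenMap_subtype_val s hs'
      have h2 := hop _ (by rintro _ ⟨z, _, rfl⟩; exact z.2) h1
      have h3 : G '' s = Subtype.val ⁻¹' (g '' (Subtype.val '' s)) := by
        ext ⟨w, hw⟩
        simp only [Set.mem_image, Set.mem_preimage, G]
        constructor
        · rintro ⟨z, hz, e⟩
          exact ⟨z, ⟨z, hz, rfl⟩, congrArg Subtype.val e⟩
        · rintro ⟨_, ⟨z, hz, rfl⟩, e⟩
          exact ⟨z, hz, Subtype.ext e⟩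
      rw [h3]
      exact h2.preimage continuous_subtype_val
    refine ⟨(Equiv.ofBijective G hGb).toHomeomorphOfContinuousOpen hGc hGo, ?_⟩
    exact hg.2.2.2

end RMT
namespace Cov
open Function

/-- left half plane -/
def HP : Set ℂ := {w | w.re < 0}

/-- punctured disk -/
def Dp : Set ℂ := {z | ‖z‖ < 1 ∧ z ≠ 0}

lemma HP_convex : Convex ℝ HP := convex_halfSpace_re_lt 0

lemma HP_open : IsOpen HP := isOpen_lt Complex.continuous_re continuous_const

lemma HP_sc : SimplyConnectedSpace HP := by
  have : ContractibleSpace HP := HP_convex.contractibleSpace ⟨-1, by simp [HP]⟩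
  infer_instance

lemma HP_lpc : LocallyPathConnectedSpace HP := HP_open.locallyPathConnectedSpace

lemma exp_lh : IsLocalHomeomorph (Complex.exp) := by
  have h1 := Complex.isCoveringMap_exp.isLocalHomeomorph
  have h2 : IsOpen {z : ℂ | z ≠ 0} := isOpen_ne
  exact h2.isOpenEmbedding_subtypeVal.isLocalHomeomorph.comp h1

lemma Dp_open : IsOpen Dp :=
  (isOpen_lt continuous_norm continuous_const).inter isOpen_ne

/-- exponential map onto the punctured disk -/
def q (k : ℕ) (hk : 0 < k) (w : HP) : Dp :=
  ⟨Complex.exp (w / k), by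
    have hw : (w : ℂ).re < 0 := w.2
    have hk' : (0 : ℝ) < k := by exact_mod_cast hk
    refine ⟨?_, Complex.exp_ne_zero _⟩
    rw [Complex.norm_exp, Real.exp_lt_one_iff, Complex.div_natCast_re]
    exact div_neg_of_neg_of_pos hw hk'⟩

lemma q_cont (k : ℕ) (hk : 0 < k) : Continuous (q k hk) := by
  unfold q
  apply Continuous.subtype_mk
  fun_prop

lemma q_surj (k : ℕ) (hk : 0 < k) : Surjective (q k hk) := by
  rintro ⟨z, hz1, hz0⟩
  have hk' : (0 : ℝ) < k := by exact_mod_cast hk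
  have hk'' : (k : ℂ) ≠ 0 := by exact_mod_cast hk.ne'
  refine ⟨⟨k * Complex.log z, ?_⟩, ?_⟩
  · show (k * Complex.log z).re < 0
    rw [show ((k : ℂ)) = ((k : ℝ) : ℂ) by simp, Complex.re_ofReal_mul, Complex.log_re]
    exact mul_neg_of_pos_of_neg hk' (Real.log_neg (norm_pos_iff.2 hz0) hz1)
  · apply Subtype.ext
    simp only [q]
    rw [mul_div_cancel_left₀ _ hk'', Complex.exp_log hz0]

lemma q_lh (k : ℕ) (hk : 0 < k) : IsLocalHomeomorph (q k hk) := by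
  have hk'' : (k : ℂ) ≠ 0 := by exact_mod_cast hk.ne'
  apply IsLocalHomeomorph.of_comp (g := Subtype.val) _
    Dp_open.isOpenEmbedding_subtypeVal.isLocalHomeomorph (q_cont k hk)
  have h1 : IsLocalHomeomorph (Subtype.val : HP → ℂ) :=
    HP_open.isOpenEmbedding_subtypeVal.isLocalHomeomorph
  have h2 : IsLocalHomeomorph (fun w : ℂ => w * (k : ℂ)⁻¹) :=
    (Homeomorph.mulRight₀ (k : ℂ)⁻¹ (inv_ne_zero hk'')).isLocalHomeomorph
  have := exp_lh.comp (h2.comp h1)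
  convert this using 1
  funext w
  simp [q, div_eq_mul_inv]

/-- translation of the half plane -/
def tr (n : ℤ) (w : HP) : HP := ⟨w + n * (2 * Real.pi * Complex.I), by
  have hw : (w : ℂ).re < 0 := w.2
  show ((w : ℂ) + n * (2 * Real.pi * Complex.I)).re < 0
  simpa using hw⟩

lemma tr_cont (n : ℤ) : Continuous (tr n) := by
  unfold tr; apply Continuous.subtype_mk; fun_prop

lemma tr_add (m n : ℤ) (w : HP) : tr (m + n) w = tr m (tr n w) := by
  apply Subtype.ext; simp [tr]; ring

lemma tr_zero (w : HP) : tr 0 w = w := by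
  apply Subtype.ext; simp [tr]

lemma q_eq_iff (k : ℕ) (hk : 0 < k) (w w' : HP) :
    q k hk w = q k hk w' ↔ ∃ n : ℤ, w = tr (k * n) w' := by
  have hk'' : (k : ℂ) ≠ 0 := by exact_mod_cast hk.ne'
  rw [Subtype.ext_iff]
  simp only [q]
  rw [Complex.exp_eq_exp_iff_exists_int]
  refine exists_congr fun n => ?_
  rw [Subtype.ext_iff]
  simp only [tr]
  rw [div_eq_iff hk'', add_mul, div_mul_cancel₀ _ hk'']
  push_cast
  rw [show (n : ℂ) * (2 * Real.pi * Complex.I) * k = k * n * (2 * Real.pi * Complex.I) by ring]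

lemma q1_tr (n : ℤ) (w : HP) : q 1 one_pos (tr n w) = q 1 one_pos w :=
  (q_eq_iff 1 one_pos _ _).2 ⟨n, by simp⟩

theorem classify {E : Type*} [TopologicalSpace E] [PreconnectedSpace E] {p : E → Dp}
    (hp : IsCoveringMap p) {k : ℕ} (hk : 0 < k)
    (hfib : ∀ v, Nat.card {z // p z = v} = k) :
    ∃ h : E ≃ₜ Dp, ∀ z, (h z : ℂ) ^ k = p z := by
  have := HP_sc
  have := HP_lpc
  have hpre : PreconnectedSpace HP := inferInstance
  let Q : C(HP, Dp) := ⟨q 1 one_pos, q_cont _ _⟩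
  have lift : ∀ (w : HP) (z : E), p z = q 1 one_pos w →
      ∃ F : C(HP, E), F w = z ∧ p ∘ F = q 1 one_pos := by
    intro w z hz
    obtain ⟨F, hF, -⟩ := hp.existsUnique_continuousMap_lifts Q w z hz
    exact ⟨F, hF⟩
  have liftlh : ∀ F : C(HP, E), p ∘ F = q 1 one_pos → IsLocalHomeomorph F := by
    intro F hF
    apply IsLocalHomeomorph.of_comp (g := p) _ hp.isLocalHomeomorph F.continuous
    rw [hF]; exact q_lh _ _
  have uniq : ∀ F F' : C(HP, E), p ∘ F = q 1 one_pos → p ∘ F' = q 1 one_pos →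
      ∀ (n : ℤ) (w : HP), F (tr n w) = F' w → ∀ w', F (tr n w') = F' w' := by
    intro F F' hF hF' n w h w'
    have := hp.eq_of_comp_eq (g₁ := F ∘ tr n) (g₂ := F') (F.continuous.comp (tr_cont n))
      F'.continuous (by
        rw [← Function.comp_assoc, hF, hF']
        funext u; exact q1_tr n u) w h
    exact congrFun this w'
  -- base lift
  let w0 : HP := ⟨-1, by simp [HP]⟩
  have hne : Nonempty {z // p z = q 1 one_pos w0} := by
    have := hfib (q 1 one_pos w0)
    by_contra hcon
    rw [not_nonempty_iff] at hcon
    rw [Nat.card_of_isEmpty] at this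
    omega
  obtain ⟨z0, hz0⟩ := hne
  obtain ⟨e, he0, hpe⟩ := lift w0 z0 hz0
  have hpe' : ∀ w, p (e w) = q 1 one_pos w := fun w => congrFun hpe w
  have hesurj : Surjective e := by
    have hopen : IsOpen (range e) := (liftlh e hpe).isOpenMap.isOpen_range
    have hclosed : IsClosed (range e) := by
      rw [← isOpen_compl_iff, isOpen_iff_forall_mem_open]
      intro z hz
      obtain ⟨w, hw⟩ := q_surj 1 one_pos (p z)
      obtain ⟨F, hF1, hF2⟩ := lift w z hw.symm
      refine ⟨range F, ?_, (liftlh F hF2).isOpenMap.isOpen_range, ⟨w, hF1⟩⟩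
      rintro _ ⟨u, rfl⟩ ⟨u', hu'⟩
      apply hz
      have h1 : q 1 one_pos u' = q 1 one_pos u := by
        rw [← hpe' u', hu']; exact congrFun hF2 u
      obtain ⟨n, hn⟩ := (q_eq_iff _ _ _ _).1 h1
      rw [hn] at hu'
      exact ⟨_, (uniq e F hpe hF2 _ u hu' w).trans hF1⟩
    have := IsClopen.eq_univ ⟨hclosed, hopen⟩ ⟨_, mem_range_self w0⟩
    exact range_eq_univ.1 this
  let S : AddSubgroup ℤ :=
    { carrier := {n | ∀ w, e (tr n w) = e w}
      zero_mem' := fun w => by rw [tr_zero]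
      add_mem' := fun {a b} ha hb w => by rw [tr_add, ha, hb]
      neg_mem' := fun {a} ha w => by
        rw [← ha (tr (-a) w), ← tr_add, add_neg_cancel, tr_zero] }
  have hS : ∀ n w, e (tr n w) = e w → n ∈ S := fun n w h => uniq e e hpe hpe n w h
  have hindex : S.index = k := by
    rw [← hfib (q 1 one_pos w0), AddSubgroup.index]
    let φ : ℤ → {z // p z = q 1 one_pos w0} := fun n => ⟨e (tr n w0), by rw [hpe', q1_tr]⟩
    have hφs : Surjective φ := by
      rintro ⟨z, hz⟩
      obtain ⟨w, rfl⟩ := hesurj z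
      rw [hpe'] at hz
      obtain ⟨n, hn⟩ := (q_eq_iff _ _ _ _).1 hz
      exact ⟨_, Subtype.ext (congrArg e hn.symm)⟩
    have hφ : ∀ a b, φ a = φ b ↔ -a + b ∈ S := by
      intro a b
      have key : tr (-a + b) (tr a w0) = tr b w0 := by rw [← tr_add]; congr 1; ring
      rw [Subtype.ext_iff]
      constructor
      · intro h
        apply hS _ (tr a w0)
        rw [key]; exact h.symm
      · intro h
        have := h (tr a w0)
        rw [key] at this; exact this.symm
    refine Nat.card_congr (Equiv.ofBijective
      (Quotient.lift φ fun a b hab => (hφ a b).2 (QuotientAddGroup.leftRel_apply.1 hab)) ⟨?_, ?_⟩)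
    · intro a b
      induction a using Quotient.inductionOn
      induction b using Quotient.inductionOn
      intro h
      exact Quotient.sound (QuotientAddGroup.leftRel_apply.2 ((hφ _ _).1 h))
    · intro z
      obtain ⟨n, hn⟩ := hφs z
      exact ⟨Quotient.mk _ n, hn⟩
  have hSk : ∀ n : ℤ, n ∈ S ↔ (k : ℤ) ∣ n := by
    obtain ⟨m, hm⟩ := Int.subgroup_cyclic S
    rw [← AddSubgroup.zmultiples_eq_closure] at hm
    intro n
    rw [hm, Int.index_zmultiples] at hindex
    rw [hm, Int.mem_zmultiples_iff, ← hindex]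
    simp
  have hfibeq : ∀ w w', e w = e w' ↔ q k hk w = q k hk w' := by
    intro w w'
    rw [q_eq_iff]
    constructor
    · intro h
      have h1 : q 1 one_pos w = q 1 one_pos w' := by rw [← hpe', h, hpe']
      obtain ⟨n, hn⟩ := (q_eq_iff _ _ _ _).1 h1
      rw [hn] at h
      obtain ⟨c, hc⟩ := (hSk _).1 (hS _ _ h)
      exact ⟨c, by rw [hn, hc]⟩
    · rintro ⟨n, rfl⟩
      exact (hSk _).2 ⟨n, rfl⟩ w'
  have heq : IsQuotientMap e := (liftlh e hpe).isOpenMap.isQuotientMap e.continuous hesurj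
  have hqq : IsQuotientMap (q k hk) :=
    (q_lh k hk).isOpenMap.isQuotientMap (q_cont k hk) (q_surj k hk)
  let A : E → Dp := fun z => q k hk (surjInv hesurj z)
  let B : Dp → E := fun z => e (surjInv (q_surj k hk) z)
  have hA : ∀ w, A (e w) = q k hk w := fun w => (hfibeq _ _).1 (surjInv_eq hesurj _)
  have hB : ∀ w, B (q k hk w) = e w := fun w => (hfibeq _ _).2 (surjInv_eq (q_surj k hk) _)
  let h : E ≃ₜ Dp :=
    { toFun := A
      invFun := B
      left_inv := fun z => by obtain ⟨w, rfl⟩ := hesurj z; rw [hA, hB]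
      right_inv := fun z => by obtain ⟨w, rfl⟩ := q_surj k hk z; rw [hB, hA]
      continuous_toFun := by
        rw [heq.continuous_iff]
        exact (q_cont k hk).congr fun w => (hA w).symm
      continuous_invFun := by
        rw [hqq.continuous_iff]
        exact e.continuous.congr fun w => (hB w).symm }
  refine ⟨h, fun z => ?_⟩
  obtain ⟨w, rfl⟩ := hesurj z
  show (A (e w) : ℂ) ^ k = _
  rw [hA, hpe']
  have hk'' : (k : ℂ) ≠ 0 := by exact_mod_cast hk.ne'
  simp only [q]
  rw [← Complex.exp_nat_mul, mul_div_cancel₀ _ hk'']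
  simp

end Cov
namespace Glue
open Function

lemma chart (q : Sph) : ∃ g : ℂ → Sph, IsOpenEmbedding g ∧ range g = {q}ᶜ := by
  have : Fact (Module.finrank ℝ (EuclideanSpace ℝ (Fin 3)) = 2 + 1) := ⟨by simp⟩
  let s := stereographic' 2 q
  have hs : s.source = {q}ᶜ := stereographic'_source q
  have ht : s.target = univ := stereographic'_target q
  have h1 : IsOpenEmbedding (fun w => s.symm w) := by
    apply s.symm.isOpenEmbedding
    simpa using ht
  let c : ℂ ≃ₜ EuclideanSpace ℝ (Fin 2) := Complex.orthonormalBasisOneI.repr.toHomeomorph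
  refine ⟨(fun w => s.symm w) ∘ c, h1.comp c.isOpenEmbedding, ?_⟩
  rw [c.surjective.range_comp, ← hs, ← s.symm_image_target_eq_source, ht, image_univ]

lemma ball_conn (c : ℂ) {r : ℝ} (hr : 0 < r) : IsConnected (Metric.ball c r \ {c}) := by
  have h : Metric.ball c r \ {c} = (fun w : ℂ => c + r * Complex.exp w) '' Cov.HP := by
    have hr' : (r : ℂ) ≠ 0 := by exact_mod_cast hr.ne'
    ext z
    simp only [Set.mem_sdiff, Metric.mem_ball, mem_singleton_iff, mem_image, Cov.HP, mem_ofPred_eq]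
    constructor
    · rintro ⟨h1, h2⟩
      have h3 : z - c ≠ 0 := sub_ne_zero.2 h2
      refine ⟨Complex.log ((z - c) / r), ?_, ?_⟩
      · rw [Complex.log_re]
        apply Real.log_neg
        · exact norm_pos_iff.2 (div_ne_zero h3 hr')
        · rw [norm_div, Complex.norm_real, Real.norm_of_nonneg hr.le, div_lt_one hr]
          rwa [dist_eq_norm] at h1
      · rw [Complex.exp_log (div_ne_zero h3 hr')]; field_simp; ring
    · rintro ⟨w, hw, rfl⟩
      constructor
      · rw [dist_eq_norm, add_sub_cancel_left, norm_mul, Complex.norm_real,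
          Real.norm_of_nonneg hr.le, Complex.norm_exp]
        have := Real.exp_lt_one_iff.2 hw
        nlinarith
      · simp [hr.ne', Complex.exp_ne_zero]
  rw [h]
  refine IsConnected.image ⟨⟨-1, by simp [Cov.HP]⟩, Cov.HP_convex.isPreconnected⟩ _ ?_
  fun_prop

lemma exists_ne (x : Sph) : -x ≠ x := by
  intro h
  have h1 : -(x : EuclideanSpace ℝ (Fin 3)) = x := congrArg Subtype.val h
  have h2 : (x : EuclideanSpace ℝ (Fin 3)) = 0 := by
    have h4 : (2 : ℝ) • (x : EuclideanSpace ℝ (Fin 3)) = 0 := by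
      rw [two_smul]; nth_rewrite 1 [← h1]; simp
    exact (smul_eq_zero.1 h4).resolve_left two_ne_zero
  have h3 : ‖(x : EuclideanSpace ℝ (Fin 3))‖ = 1 := by simp
  rw [h2] at h3; simp at h3

lemma nbhd (x : Sph) {O : Set Sph} (hO : O ∈ 𝓝 x) :
    ∃ N : Set Sph, IsOpen N ∧ x ∈ N ∧ N ⊆ O ∧ IsConnected (N \ {x}) := by
  obtain ⟨g, hg, hr⟩ := chart (-x)
  have hx : x ∈ range g := by rw [hr]; exact (exists_ne x).symm
  obtain ⟨a, rfl⟩ := hx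
  have h1 : g ⁻¹' O ∈ 𝓝 a := hg.continuous.continuousAt hO
  obtain ⟨r, hr0, hb⟩ := Metric.mem_nhds_iff.1 h1
  refine ⟨g '' Metric.ball a r, hg.isOpenMap _ Metric.isOpen_ball,
    ⟨a, Metric.mem_ball_self hr0, rfl⟩, image_subset_iff.2 hb, ?_⟩
  rw [← image_singleton, ← image_sdiff hg.injective]
  exact (ball_conn a hr0).image _ hg.continuous.continuousOn

lemma conn_diff {U : Set Sph} (hU : IsOpen U) (hc : IsPreconnected U) (x : Sph) :
    IsPreconnected (U \ {x}) := by
  by_cases hx : x ∈ U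
  swap
  · rwa [sdiff_singleton_eq_self hx]
  obtain ⟨N, hN, hxN, hNU, hNc⟩ := nbhd x (hU.mem_nhds hx)
  rw [isPreconnected_iff_subset_of_disjoint]
  have key : ∀ u v : Set Sph, IsOpen u → IsOpen v → U \ {x} ⊆ u ∪ v →
      (U \ {x}) ∩ (u ∩ v) = ∅ → N \ {x} ⊆ u → U \ {x} ⊆ u := by
    intro u v hu hv huv hd hNu
    have hUx : IsOpen (U \ {x}) := hU.sdiff isClosed_singleton
    have := isPreconnected_iff_subset_of_disjoint.1 hc ((u ∩ (U \ {x})) ∪ N) (v ∩ (U \ {x}))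
      ((hu.inter hUx).union hN) (hv.inter hUx) ?_ ?_
    · rcases this with h | h
      · intro z hz
        rcases h hz.1 with h' | h'
        · exact h'.1
        · exact hNu ⟨h', hz.2⟩
      · exact absurd rfl (h hx).2.2
    · intro z hz
      by_cases hzx : z = x
      · subst hzx; exact Or.inl (Or.inr hxN)
      · rcases huv ⟨hz, hzx⟩ with h | h
        · exact Or.inl (Or.inl ⟨h, hz, hzx⟩)
        · exact Or.inr ⟨h, hz, hzx⟩
    · rw [eq_empty_iff_forall_notMem] at hd ⊢
      rintro z ⟨hz, h1, h2⟩
      apply hd z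
      refine ⟨h2.2, ?_, h2.1⟩
      rcases h1 with h1 | h1
      · exact h1.1
      · exact hNu ⟨h1, h2.2.2⟩
  intro u v hu hv huv hd
  have hsub : N \ {x} ⊆ U \ {x} := sdiff_subset_sdiff_left hNU
  rcases isPreconnected_iff_subset_of_disjoint.1 hNc.isPreconnected u v hu hv (hsub.trans huv)
    (subset_eq_empty (inter_subset_inter_left _ hsub) hd) with h | h
  · exact Or.inl (key u v hu hv huv hd h)
  · exact Or.inr (key v u hv hu (by rwa [union_comm]) (by rwa [inter_comm v u]) h)

lemma conn_diff_finite {U : Set Sph} (hU : IsOpen U) (hc : IsPreconnected U) {S : Set Sph}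
    (hS : S.Finite) : IsPreconnected (U \ S) := by
  induction S, hS using Set.Finite.induction_on with
  | empty => simpa using hc
  | @insert a s _ hs ih =>
    have : U \ insert a s = (U \ s) \ {a} := by
      rw [sdiff_sdiff, union_singleton]
    rw [this]
    exact conn_diff (hU.sdiff hs.isClosed) ih a

lemma final (f : Sph → Sph) (hf : Continuous f) (x : Sph) (k : ℕ) (hk : 0 < k) (U V : Set Sph)
    (hU : IsOpen U) (hV : IsOpen V) (hxU : x ∈ U) (hyV : f x ∈ V)
    (ψ : V ≃ₜ unitDisk) (hψ : (ψ ⟨f x, hyV⟩ : ℂ) = 0)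
    (hmaps : Set.MapsTo f (U \ {x}) (V \ {f x})) (h : ↥(U \ {x}) ≃ₜ Cov.Dp)
    (hh : ∀ z : ↥(U \ {x}), (h z : ℂ) ^ k = ψ ⟨f z, (hmaps z.2).1⟩) : IsRamifiedAt f x k := by
  classical
  have hUx : IsOpen (U \ {x}) := hU.sdiff isClosed_singleton
  have hmU : MapsTo f U V := by
    intro z hz
    by_cases hzx : z = x
    · rw [hzx]; exact hyV
    · exact (hmaps ⟨hz, hzx⟩).1
  let Φ : Sph → ℂ := fun z => if hz : z ∈ U \ {x} then (h ⟨z, hz⟩ : ℂ) else 0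
  have Φx : Φ x = 0 := by simp [Φ]
  have Φh : ∀ z : ↥(U \ {x}), Φ z = h z := by
    intro z
    simp only [Φ]
    rw [dif_pos z.2]
  have hpow : ∀ z : U, (ψ ⟨f z, hmU z.2⟩ : ℂ) = Φ z ^ k := by
    rintro ⟨z, hz⟩
    by_cases hzx : z = x
    · subst hzx
      simp only [Φx]
      rw [zero_pow hk.ne']; exact hψ
    · rw [Φh ⟨z, hz, hzx⟩, hh]
  have hc1 : ContinuousOn Φ (U \ {x}) := by
    rw [continuousOn_iff_continuous_domRestrict]
    have : (U \ {x}).domRestrict Φ = Subtype.val ∘ h := funext Φh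
    rw [this]
    exact continuous_subtype_val.comp h.continuous
  have hc0 : ContinuousAt Φ x := by
    have h1 : ContinuousAt (fun z : U => Φ z) ⟨x, hxU⟩ := by
      have h2 : Continuous (fun z : U => ‖(ψ ⟨f z, hmU z.2⟩ : ℂ)‖) := by
        refine continuous_norm.comp (continuous_subtype_val.comp (ψ.continuous.comp ?_))
        exact Continuous.subtype_mk (hf.comp continuous_subtype_val) _
      rw [Metric.continuousAt_iff']
      intro ε hε
      have h3 := h2.continuousAt (x := ⟨x, hxU⟩)
      have h4 : ∀ᶠ z : U in 𝓝 ⟨x, hxU⟩, ‖(ψ ⟨f z, hmU z.2⟩ : ℂ)‖ < ε ^ k := by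
        apply h3.eventually_lt_const
        simp only [hψ, norm_zero]
        positivity
      filter_upwards [h4] with z hz
      simp only [Φx, dist_zero_right]
      rw [hpow, norm_pow] at hz
      exact lt_of_pow_lt_pow_left₀ k hε.le hz
    exact (hU.isOpenEmbedding_subtypeVal.continuousAt_iff (x := ⟨x, hxU⟩)).1 h1
  have hc : ContinuousOn Φ U := by
    intro z hz
    by_cases hzx : z = x
    · rw [hzx]; exact hc0.continuousWithinAt
    · exact (hc1.continuousAt (hUx.mem_nhds ⟨hz, hzx⟩)).continuousWithinAt
  have hne : ∀ z ∈ U, z ≠ x → Φ z ≠ 0 := by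
    intro z hz hzx
    rw [Φh ⟨z, hz, hzx⟩]
    exact (h _).2.2
  have hinj : InjOn Φ U := by
    intro z hz w hw e
    by_cases hzx : z = x
    · by_cases hwx : w = x
      · rw [hzx, hwx]
      · rw [hzx, Φx] at e; exact absurd e.symm (hne w hw hwx)
    · by_cases hwx : w = x
      · rw [hwx, Φx] at e; exact absurd e (hne z hz hzx)
      · rw [Φh ⟨z, hz, hzx⟩, Φh ⟨w, hw, hwx⟩] at e
        exact congrArg Subtype.val (h.injective (Subtype.ext e))
  have hmD : ∀ z ∈ U, Φ z ∈ unitDisk := by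
    intro z hz
    by_cases hzx : z = x
    · rw [hzx, Φx]; simp [unitDisk]
    · rw [Φh ⟨z, hz, hzx⟩]
      have := (h ⟨z, hz, hzx⟩).2.1
      simpa [unitDisk] using this
  let j : Cov.Dp → Sph := fun w => (h.symm w).1
  have hj : Continuous j := continuous_subtype_val.comp h.symm.continuous
  have hjU : ∀ w, j w ∈ U \ {x} := fun w => (h.symm w).2
  have hjΦ : ∀ w, Φ (j w) = w := by
    intro w
    rw [Φh (h.symm w), h.apply_symm_apply]
  have hopen : ∀ O ⊆ U, IsOpen O → IsOpen (Φ '' O) := by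
    intro O hOU hO
    rw [isOpen_iff_mem_nhds]
    rintro _ ⟨z, hz, rfl⟩
    by_cases hzx : z = x
    · subst hzx
      rw [Φx]
      obtain ⟨K, hK, hxK, hKO⟩ := exists_compact_subset hO hz
      have hfr : IsCompact (frontier K) := isClosed_frontier.isCompact
      have hfK : frontier K ⊆ K := hK.isClosed.frontier_subset
      have hcl : IsClosed (Φ '' frontier K) :=
        (hfr.image_of_continuousOn (hc.mono (hfK.trans (hKO.trans hOU)))).isClosed
      have h0 : (0 : ℂ) ∉ Φ '' frontier K := by
        rintro ⟨y, hy, e⟩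
        have : y = z := by
          by_contra hyz
          exact hne y (hOU (hKO (hfK hy))) hyz e
        rw [this] at hy
        exact hy.2 hxK
      obtain ⟨δ, hδ, hb⟩ := Metric.mem_nhds_iff.1 (hcl.isOpen_compl.mem_nhds h0)
      set r := min δ 1
      have hr : 0 < r := lt_min hδ one_pos
      have hBD : Metric.ball (0 : ℂ) r \ {0} ⊆ Cov.Dp := by
        rintro w ⟨hw, hw0⟩
        refine ⟨?_, hw0⟩
        have : ‖w‖ < r := by simpa using hw
        exact this.trans_le (min_le_right _ _)
      let P : Set Cov.Dp := Subtype.val ⁻¹' (Metric.ball (0 : ℂ) r \ {0})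
      have hP : IsPreconnected P := by
        rw [← IsInducing.subtypeVal.isPreconnected_image]
        have : Subtype.val '' P = Metric.ball (0 : ℂ) r \ {0} := by
          rw [Subtype.image_preimage_coe, inter_eq_right]; exact hBD
        rw [this]
        exact (ball_conn 0 hr).isPreconnected
      have hW : IsPreconnected (j '' P) := hP.image _ hj.continuousOn
      have hWf : ∀ w ∈ P, j w ∉ frontier K := by
        intro w hw hjw
        have h5 : (w : ℂ) ∈ Metric.ball (0 : ℂ) δ := Metric.ball_subset_ball (min_le_left _ _) hw.1
        exact hb h5 ⟨j w, hjw, hjΦ w⟩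
      have hWsub : j '' P ⊆ interior K := by
        refine IsPreconnected.subset_left_of_subset_union isOpen_interior hK.isClosed.isOpen_compl
          ?_ ?_ ?_ hW
        · exact disjoint_compl_right.mono_left interior_subset
        · rintro _ ⟨w, hw, rfl⟩
          by_cases hk1 : j w ∈ interior K
          · exact Or.inl hk1
          · right
            intro hk2
            exact hWf w hw ⟨subset_closure hk2, hk1⟩
        · have h6 : Φ ⁻¹' (Metric.ball (0 : ℂ) r) ∩ interior K ∈ 𝓝 z := by
            refine inter_mem (hc0 ?_) (isOpen_interior.mem_nhds hxK)
            rw [Φx]; exact Metric.ball_mem_nhds _ hr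
          obtain ⟨N, _, _, hN, hNc⟩ := nbhd z h6
          obtain ⟨y, hy, hyz⟩ := hNc.nonempty
          have hyU : y ∈ U := hOU (hKO (interior_subset (hN hy).2))
          refine ⟨y, ⟨h ⟨y, hyU, hyz⟩, ?_, ?_⟩, (hN hy).2⟩
          · show (h ⟨y, hyU, hyz⟩ : ℂ) ∈ Metric.ball (0 : ℂ) r \ {0}
            rw [← Φh]
            exact ⟨(hN hy).1, hne y hyU hyz⟩
          · simp [j]
      refine Filter.mem_of_superset (Metric.ball_mem_nhds _ hr) ?_
      intro w hw
      by_cases hw0 : w = 0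
      · exact ⟨z, hz, by rw [Φx, hw0]⟩
      · have hwD := hBD ⟨hw, hw0⟩
        exact ⟨j ⟨w, hwD⟩, hKO (interior_subset (hWsub ⟨⟨w, hwD⟩, ⟨hw, hw0⟩, rfl⟩)), hjΦ _⟩
    · have h1 : IsOpen (Subtype.val '' (h '' (Subtype.val ⁻¹' O))) :=
        Cov.Dp_open.isOpenMap_subtype_val _ (h.isOpenMap _ (hO.preimage continuous_subtype_val))
      refine Filter.mem_of_superset (h1.mem_nhds (x := Φ z)
        ⟨h ⟨z, hOU hz, hzx⟩, ⟨_, hz, rfl⟩, (Φh ⟨z, hOU hz, hzx⟩).symm⟩) ?_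
      rintro _ ⟨_, ⟨y, hy, rfl⟩, rfl⟩
      exact ⟨y, hy, Φh y⟩
  let G : U → unitDisk := fun z => ⟨Φ z, hmD z z.2⟩
  have hGc : Continuous G := by
    apply Continuous.subtype_mk
    exact continuousOn_iff_continuous_domRestrict.1 hc
  have hGb : Bijective G := by
    constructor
    · intro z z' e
      exact Subtype.ext (hinj z.2 z'.2 (congrArg Subtype.val e))
    · rintro ⟨w, hw⟩
      by_cases hw0 : w = 0
      · exact ⟨⟨x, hxU⟩, Subtype.ext (Φx.trans hw0.symm)⟩
      · have hw1 : w ∈ Cov.Dp := ⟨by simpa [unitDisk] using hw, hw0⟩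
        exact ⟨⟨j ⟨w, hw1⟩, (hjU _).1⟩, Subtype.ext (hjΦ ⟨w, hw1⟩)⟩
  have hGo : IsOpenMap G := by
    intro s hs'
    have h1 : IsOpen (Subtype.val '' s) := hU.isOpenMap_subtype_val s hs'
    have h2 := hopen _ (by rintro _ ⟨z, _, rfl⟩; exact z.2) h1
    have h3 : G '' s = Subtype.val ⁻¹' (Φ '' (Subtype.val '' s)) := by
      ext ⟨w, hw⟩
      simp only [Set.mem_image, Set.mem_preimage, G]
      constructor
      · rintro ⟨z, hz, e⟩
        exact ⟨z, ⟨z, hz, rfl⟩, congrArg Subtype.val e⟩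
      · rintro ⟨_, ⟨z, hz, rfl⟩, e⟩
        exact ⟨z, hz, Subtype.ext e⟩
    rw [h3]
    exact h2.preimage continuous_subtype_val
  exact ⟨hk, U, V, hxU, hyV, hmU, hU, hV,
    (Equiv.ofBijective G hGb).toHomeomorphOfContinuousOpen hGc hGo, ψ, Φx, hψ, hpow⟩

lemma disk_chart {V : Set Sph} (hV : IsOpen V) (hs : IsSimplyConnected V) (hne : V ≠ univ)
    {y : Sph} (hy : y ∈ V) : ∃ ψ : V ≃ₜ unitDisk, (ψ ⟨y, hy⟩ : ℂ) = 0 := by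
  obtain ⟨q, hq⟩ := (ne_univ_iff_exists_notMem V).1 hne
  obtain ⟨g, hg, hr⟩ := chart q
  have hVr : V ⊆ range g := by
    rw [hr]; intro v hv e
    rw [mem_singleton_iff] at e
    exact hq (e ▸ hv)
  have him : g '' (g ⁻¹' V) = V := image_preimage_eq_of_subset hVr
  obtain ⟨a, rfl⟩ := hVr hy
  have hs' : IsSimplyConnected (g ⁻¹' V) := by
    rw [← him] at hs
    exact (hg.isEmbedding.isSimplyConnected_image).1 hs
  obtain ⟨e, he⟩ := RMT.riemann (hV.preimage hg.continuous) hs' (a := a) hy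
  let m : (g ⁻¹' V) ≃ₜ V := (hg.isEmbedding.homeomorphImage _).trans (Homeomorph.setCongr him)
  have hm : m ⟨a, hy⟩ = ⟨g a, hy⟩ := rfl
  refine ⟨m.symm.trans e, ?_⟩
  rw [← hm]
  simp [he]

/-- puncturing a disk chart -/
def punct {V : Set Sph} {y : Sph} (hy : y ∈ V) (ψ : V ≃ₜ unitDisk)
    (h0 : (ψ ⟨y, hy⟩ : ℂ) = 0) : ↥(V \ {y}) ≃ₜ Cov.Dp where
  toFun v := ⟨ψ ⟨v, v.2.1⟩, by
    constructor
    · exact mem_ball_zero_iff.1 (ψ ⟨v, v.2.1⟩).2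
    · intro h
      have h1 : ψ ⟨v, v.2.1⟩ = ψ ⟨y, hy⟩ := Subtype.ext (h.trans h0.symm)
      exact v.2.2 (congrArg Subtype.val (ψ.injective h1))⟩
  invFun w := ⟨ψ.symm ⟨w, by simpa [unitDisk] using w.2.1⟩, by
    refine ⟨Subtype.prop _, ?_⟩
    intro h
    have h1 : ψ.symm ⟨w, by simpa [unitDisk] using w.2.1⟩ = ⟨y, hy⟩ := Subtype.ext h
    rw [ψ.symm_apply_eq] at h1
    exact w.2.2 ((congrArg Subtype.val h1).trans h0)⟩
  left_inv v := by simp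
  right_inv w := by simp
  continuous_toFun := by
    apply Continuous.subtype_mk
    refine continuous_subtype_val.comp (ψ.continuous.comp ?_)
    exact Continuous.subtype_mk continuous_subtype_val _
  continuous_invFun := by
    apply Continuous.subtype_mk
    refine continuous_subtype_val.comp (ψ.symm.continuous.comp ?_)
    exact Continuous.subtype_mk continuous_subtype_val _

lemma core (f : Sph → Sph) (hf : Continuous f)
    (x : Sph) (k : ℕ) (hk : 0 < k) (U V : Set Sph) (hU : IsOpen U) (hV : IsOpen V)
    (hxU : x ∈ U) (hyV : f x ∈ V) (hUc : IsPreconnected (U \ {x}))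
    (hVsc : IsSimplyConnected V) (hVne : V ≠ univ)
    (hmaps : Set.MapsTo f (U \ {x}) (V \ {f x}))
    (hcov : IsCoveringMap fun z : ↥(U \ {x}) => (⟨f z, hmaps z.2⟩ : ↥(V \ {f x})))
    (hfib : ∀ v : ↥(V \ {f x}),
      Nat.card {z : ↥(U \ {x}) // f (z : Sph) = (v : Sph)} = k) :
    IsRamifiedAt f x k := by
  obtain ⟨ψ, hψ⟩ := disk_chart hV hVsc hVne hyV
  have : PreconnectedSpace ↥(U \ {x}) := isPreconnected_iff_preconnectedSpace.1 hUc
  have hp := hcov.homeomorph_comp (punct hyV ψ hψ)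
  obtain ⟨h, hh⟩ := Cov.classify hp hk (by
    intro w
    rw [← hfib ((punct hyV ψ hψ).symm w)]
    apply Nat.card_congr
    refine Equiv.subtypeEquivRight ?_
    intro z
    rw [comp_apply, ← Homeomorph.eq_symm_apply, Subtype.ext_iff])
  exact final f hf x k hk U V hU hV hxU hyV ψ hψ hmaps h hh

lemma compl_sc (q : Sph) : IsSimplyConnected ({q}ᶜ : Set Sph) := by
  obtain ⟨g, hg, hr⟩ := chart q
  rw [← hr, ← image_univ, hg.isEmbedding.isSimplyConnected_image]
  have : ContractibleSpace (univ : Set ℂ) := convex_univ.contractibleSpace ⟨(0 : ℂ), trivial⟩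
  show SimplyConnectedSpace (univ : Set ℂ)
  infer_instance

lemma main_univ (f : Sph → Sph) (hf : Continuous f)
    (x : Sph) (k : ℕ) (hk : 0 < k) (U : Set Sph) (hU : IsOpen U)
    (hxU : x ∈ U) (hUc : IsPreconnected U)
    (hmaps : Set.MapsTo f (U \ {x}) (univ \ {f x}))
    (hcov : IsCoveringMap fun z : ↥(U \ {x}) => (⟨f z, hmaps z.2⟩ : ↥(univ \ {f x})))
    (hfib : ∀ v : ↥(univ \ {f x}),
      Nat.card {z : ↥(U \ {x}) // f (z : Sph) = (v : Sph)} = k) :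
    IsRamifiedAt f x k := by
  obtain ⟨q, hq⟩ : ∃ q, q ≠ f x := ⟨-f x, exists_ne _⟩
  have hfin : (U \ {x} ∩ f ⁻¹' {q}).Finite := by
    have h1 : Nat.card {z : ↥(U \ {x}) // f (z : Sph) = q} = k := hfib ⟨q, trivial, hq⟩
    have h2 : Finite {z : ↥(U \ {x}) // f (z : Sph) = q} :=
      Nat.finite_of_card_ne_zero (by rw [h1]; exact hk.ne')
    have h3 : U \ {x} ∩ f ⁻¹' {q} =
        range (fun z : {z : ↥(U \ {x}) // f (z : Sph) = q} => (z.1.1 : Sph)) := by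
      ext z
      constructor
      · rintro ⟨h, h'⟩
        exact ⟨⟨⟨z, h⟩, h'⟩, rfl⟩
      · rintro ⟨w, rfl⟩
        exact ⟨w.1.2, w.2⟩
    rw [h3]
    exact finite_range _
  have hU' : IsOpen (U \ f ⁻¹' {q}) := hU.sdiff (isClosed_singleton.preimage hf)
  have hmaps' : MapsTo f ((U \ f ⁻¹' {q}) \ {x}) ({q}ᶜ \ {f x}) := by
    rintro z ⟨⟨h1, h2⟩, h3⟩
    exact ⟨h2, (hmaps ⟨h1, h3⟩).2⟩
  let t : Set ↥(univ \ {f x}) := {v | v.1 ≠ q}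
  let p := fun z : ↥(U \ {x}) => (⟨f z, hmaps z.2⟩ : ↥(univ \ {f x}))
  let α : ↥((U \ f ⁻¹' {q}) \ {x}) ≃ₜ ↥(p ⁻¹' t) :=
    { toFun := fun z => ⟨⟨z, z.2.1.1, z.2.2⟩, z.2.1.2⟩
      invFun := fun z => ⟨z.1.1, ⟨z.1.2.1, z.2⟩, z.1.2.2⟩
      left_inv := fun z => rfl
      right_inv := fun z => rfl
      continuous_toFun := by fun_prop
      continuous_invFun := by fun_prop }
  let β : ↥t ≃ₜ ↥(({q}ᶜ : Set Sph) \ {f x}) :=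
    { toFun := fun z => ⟨z.1.1, z.2, z.1.2.2⟩
      invFun := fun z => ⟨⟨z, trivial, z.2.2⟩, z.2.1⟩
      left_inv := fun z => rfl
      right_inv := fun z => rfl
      continuous_toFun := by fun_prop
      continuous_invFun := by fun_prop }
  have hcov' := ((hcov.restrictPreimage t).comp_homeomorph α).homeomorph_comp β
  refine core f hf x k hk (U \ f ⁻¹' {q}) {q}ᶜ hU' isOpen_compl_singleton
    ⟨hxU, fun h => hq h.symm⟩ (fun h => hq h.symm) ?_ (compl_sc q) ?_ hmaps' hcov' ?_
  · have : (U \ f ⁻¹' {q}) \ {x} = (U \ {x}) \ (U \ {x} ∩ f ⁻¹' {q}) := by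
      ext z
      simp only [Set.mem_sdiff, mem_inter_iff]
      tauto
    rw [this]
    exact conn_diff_finite (hU.sdiff isClosed_singleton) (conn_diff hU hUc x) hfin
  · intro h
    have : q ∈ ({q}ᶜ : Set Sph) := h ▸ mem_univ q
    exact this rfl
  · intro v
    rw [← hfib ⟨v, trivial, v.2.2⟩]
    apply Nat.card_congr
    exact
      { toFun := fun z => ⟨⟨z.1.1, z.1.2.1.1, z.1.2.2⟩, z.2⟩
        invFun := fun z => ⟨⟨z.1.1, ⟨z.1.2.1, fun h => v.2.1 (z.2.symm.trans h)⟩, z.1.2.2⟩, z.2⟩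
        left_inv := fun z => rfl
        right_inv := fun z => rfl }

end Glue

/-- If `f : S² → S²` is continuous, `U ∋ x` and `V ∋ f x` are open simply
connected sets such that `f` restricts to a `k`-to-1 covering map `U ∖ {x} → V ∖ {f x}`,
then `f` is a ramified covering of local degree `k` at `x`. -/
theorem ramified_of_punctured_covering (f : Sph → Sph) (hf : Continuous f)
    (x : Sph) (k : ℕ) (hk : 0 < k) (U V : Set Sph) (hU : IsOpen U) (hV : IsOpen V)
    (hxU : x ∈ U) (hyV : f x ∈ V)
    (hUsc : SimplyConnectedSpace U) (hVsc : SimplyConnectedSpace V)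
    (hmaps : Set.MapsTo f (U \ {x}) (V \ {f x}))
    (hcov : IsCoveringMap fun z : ↥(U \ {x}) => (⟨f z, hmaps z.2⟩ : ↥(V \ {f x})))
    (hfib : ∀ v : ↥(V \ {f x}),
      Nat.card {z : ↥(U \ {x}) // f (z : Sph) = (v : Sph)} = k) :
    IsRamifiedAt f x k := by
  have hc : IsPreconnected U := by
    rw [isPreconnected_iff_preconnectedSpace]
    infer_instance
  by_cases hne : V = univ
  · subst hne
    exact Glue.main_univ f hf x k hk U hU hxU hc hmaps hcov hfib
  · exact Glue.core f hf x k hk U V hU hV hxU hyV (Glue.conn_diff hU hc x) hVsc hne hmaps hcov hfib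
end
end

section
/- Suppose F_t, t ∈ [0,1], is a continuous family of Thurston maps of degree 2 (that is, (t, z) ↦ F_t(z) is continuous on [0,1] × S², and each F_t is a Thurston map of degree 2) such that the cardinality of the post-critical set P_{F_t} is the same for all t ∈ [0,1]. Then F₀ is Thurston equivalent to F₁. -/
open Set Filter Topology

noncomputable section

/-- The post-critical set of `F`: the union of the forward orbits (from time 1 on) of the
critical points of `F`. -/
def postCritical (F : Sph → Sph) : Set Sph :=
  ⋃ n ∈ {n : ℕ | 1 ≤ n}, F^[n] '' {x | IsCriticalPt F x}

/-- A Thurston map: a ramified covering of the sphere with finite post-critical set. -/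
def IsThurstonMap (F : Sph → Sph) : Prop :=
  IsRamifiedCovering F ∧ (postCritical F).Finite

/-- `F` has degree 2: every point that is not a critical value has exactly two preimages. -/
def HasDegreeTwo (F : Sph → Sph) : Prop :=
  ∀ y : Sph, ¬IsCriticalValue F y → Nat.card (F ⁻¹' {y} : Set Sph) = 2

/-- Thurston equivalence of two Thurston maps `F` and `G`: there are homeomorphisms `φ, ψ` of
the sphere with `φ ∘ F = G ∘ ψ` such that `φ` and `ψ` are homotopic relative to the
post-critical set of `F`. -/
def ThurstonEquiv (F G : Sph → Sph) : Prop :=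
  ∃ φ ψ : Sph ≃ₜ Sph, (∀ x, φ (F x) = G (ψ x)) ∧
    ContinuousMap.HomotopicRel (φ : C(Sph, Sph)) (ψ : C(Sph, Sph)) (postCritical F)

theorem zero_lemma {r : ℝ} (hr : 0 < r) (g : ℂ → ℂ) (hg : ContinuousOn g (Metric.closedBall 0 r))
    (h : ∀ z, ‖z‖ = r → ‖g z - z‖ < r) : ∃ z ∈ Metric.closedBall (0 : ℂ) r, g z = 0 := by
  by_contra hcon
  push Not at hcon
  have hmem : ∀ (s : unitInterval) (θ : ℝ),
      ((s : ℝ) * r : ℂ) * Complex.exp (θ * Complex.I) ∈ Metric.closedBall (0 : ℂ) r := by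
    intro s θ
    simp only [mem_closedBall_zero_iff, norm_mul, Complex.norm_real, Complex.norm_exp_ofReal_mul_I,
      mul_one, Real.norm_eq_abs, abs_of_pos hr, abs_of_nonneg s.2.1]
    nlinarith [s.2.2]
  let H : C(unitInterval × ℝ, {z : ℂ // z ≠ 0}) :=
    ⟨fun p => ⟨g (((p.1 : ℝ) * r : ℂ) * Complex.exp (p.2 * Complex.I)), hcon _ (hmem _ _)⟩, by
      refine Continuous.subtype_mk ?_ _
      refine hg.comp_continuous ?_ (fun p => hmem _ _)
      fun_prop⟩
  let cov := Complex.isCoveringMap_exp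
  let f : C(ℝ, ℂ) := ContinuousMap.const _ (Complex.log (g 0))
  have g0 : g 0 ≠ 0 := hcon 0 (by simp [hr.le])
  have H0 : ∀ a, H (0, a) = (fun z : ℂ ↦ (⟨_, z.exp_ne_zero⟩ : {z : ℂ // z ≠ 0})) (f a) := by
    intro a
    apply Subtype.ext
    simp [H, f, Complex.exp_log g0]
  let L := cov.liftHomotopy H f H0
  have hL : ∀ p, Complex.exp (L p) = H p := fun p =>
    congrArg Subtype.val (congrFun (cov.liftHomotopy_lifts H f H0) p)
  have hper : L (1, 2 * Real.pi) = L (1, 0) := by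
    have := cov.eq_of_comp_eq (A := unitInterval) (g₁ := fun s => L (s, 2 * Real.pi))
      (g₂ := fun s => L (s, 0)) (by fun_prop) (by fun_prop) ?_ 0 ?_
    · exact congrFun this 1
    · funext s
      apply Subtype.ext
      simp only [Function.comp]
      rw [hL, hL]
      simp [H, Complex.exp_two_pi_mul_I]
    · simp only [L]
      rw [cov.liftHomotopy_zero, cov.liftHomotopy_zero]; rfl
  have hz : ∀ θ : ℝ, ‖(r : ℂ) * Complex.exp (θ * Complex.I)‖ = r := by
    intro θ
    simp [Complex.norm_exp_ofReal_mul_I, abs_of_pos hr]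
  have hz0 : ∀ θ : ℝ, (r : ℂ) * Complex.exp (θ * Complex.I) ≠ 0 := by
    intro θ h0
    have := hz θ
    rw [h0] at this
    simp at this
    exact hr.ne this
  let q : ℝ → ℂ := fun θ => g ((r : ℂ) * Complex.exp (θ * Complex.I)) /
      ((r : ℂ) * Complex.exp (θ * Complex.I))
  have hq : ∀ θ, q θ ∈ Complex.slitPlane := by
    intro θ
    have : q θ = 1 + (q θ - 1) := by ring
    rw [this]
    apply Complex.mem_slitPlane_of_norm_lt_one
    have h1 : q θ - 1 = (g ((r : ℂ) * Complex.exp (θ * Complex.I)) -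
      ((r : ℂ) * Complex.exp (θ * Complex.I))) / ((r : ℂ) * Complex.exp (θ * Complex.I)) := by
      simp only [q]; rw [sub_div, div_self (hz0 θ)]
    rw [h1, norm_div, hz θ, div_lt_one hr]
    exact h _ (hz θ)
  have hqc : Continuous q := by
    refine Continuous.div ?_ (by fun_prop) hz0
    refine hg.comp_continuous (by fun_prop) (fun θ => ?_)
    rw [mem_closedBall_zero_iff, hz]
  let k : ℝ → ℂ := fun θ => L (1, θ) - Complex.log (q θ) - θ * Complex.I
  have hkc : Continuous k := by
    refine (Continuous.sub (by fun_prop) (hqc.clog hq)).sub (by fun_prop)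
  have hke : ∀ θ, Complex.exp (k θ) = r := by
    intro θ
    simp only [k]
    rw [Complex.exp_sub, Complex.exp_sub, hL, Complex.exp_log (Complex.slitPlane_ne_zero (hq θ))]
    have hg0 : g ((r : ℂ) * Complex.exp (θ * Complex.I)) ≠ 0 := by
      apply hcon; rw [mem_closedBall_zero_iff, hz]
    have hr' : (r : ℂ) ≠ 0 := by exact_mod_cast hr.ne'
    simp only [H, q, ContinuousMap.coe_mk, Set.Icc.coe_one, Complex.ofReal_one, one_mul]
    field_simp
  have := cov.const_of_comp hkc (fun a a' => Subtype.ext (by simp only [hke])) (2 * Real.pi) 0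
  simp only [k, hper, q] at this
  simp [Complex.exp_two_pi_mul_I, Real.pi_ne_zero] at this

theorem tendsto_of_unique {A B ι : Type*} [TopologicalSpace A] [TopologicalSpace B] [CompactSpace A]
    [T2Space B] {Φ : A → B} (hΦ : Continuous Φ) {a : A} (ha : ∀ a', Φ a' = Φ a → a' = a)
    {l : Filter ι} {f : ι → A} (hf : Tendsto (Φ ∘ f) l (𝓝 (Φ a))) : Tendsto f l (𝓝 a) := by
  have h1 := hΦ.isClosedMap.comap_nhds_eq hΦ (Φ a)
  have h2 : Φ ⁻¹' {Φ a} = {a} := by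
    ext x; exact ⟨fun h => ha x h, fun h => by rw [h]; rfl⟩
  rw [h2, nhdsSet_singleton] at h1
  rw [← h1, tendsto_comap_iff]
  exact hf

theorem open_family {T X Y : Type*} [TopologicalSpace T] [TopologicalSpace X] [TopologicalSpace Y]
    [CompactSpace X] [T2Space X] [T2Space Y] [LocallyConnectedSpace Y] {G : T → X → Y}
    (hc : Continuous fun p : T × X => G p.1 p.2) (ho : ∀ t, IsOpenMap (G t))
    (hfin : ∀ t y, (G t ⁻¹' {y}).Finite) :
    IsOpenMap fun p : T × X => (p.1, G p.1 p.2) := by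
  rw [isOpenMap_iff_nhds_le]
  rintro ⟨t0, x0⟩ N hN
  rw [mem_map, mem_nhds_prod_iff] at hN
  obtain ⟨A, hA, B, hB, hAB⟩ := hN
  have hF : (G t0 ⁻¹' {G t0 x0} \ {x0})ᶜ ∈ 𝓝 x0 := by
    apply (((hfin t0 (G t0 x0)).subset sdiff_subset).isClosed.isOpen_compl).mem_nhds
    simp
  obtain ⟨C, hC, hCc, hCB⟩ := exists_mem_nhds_isClosed_subset (inter_mem hB hF)
  let O := interior C
  have hx0 : x0 ∈ O := mem_interior_iff_mem_nhds.2 hC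
  have hOC : closure O ⊆ C := hCc.closure_subset_iff.2 interior_subset
  have hfr : IsCompact (closure O \ O) := (isClosed_closure.sdiff isOpen_interior).isCompact
  have hev : ∀ᶠ p : T × Y in 𝓝 (t0, G t0 x0), ∀ x ∈ closure O \ O, G p.1 x ≠ p.2 := by
    apply hfr.eventually_forall_of_forall_eventually
    intro x hx
    have h1 : Continuous fun z : (T × Y) × X => G z.1.1 z.2 :=
      hc.comp (by fun_prop : Continuous fun z : (T × Y) × X => (z.1.1, z.2))
    have h2 : Continuous fun z : (T × Y) × X => z.1.2 := by fun_prop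
    apply (isOpen_ne_fun h1 h2).mem_nhds
    simp only [mem_ofPred_eq, ne_eq]
    intro he
    have := (hCB (hOC hx.1)).2
    apply this
    refine ⟨he, ?_⟩
    rintro rfl
    exact hx.2 hx0
  rw [nhds_prod_eq, eventually_prod_iff] at hev
  obtain ⟨pa, hpa, pb, hpb, hp⟩ := hev
  obtain ⟨Y', ⟨hYo, hY0, hYc⟩, hY'⟩ :=
    (locallyConnectedSpace_iff_hasBasis_isOpen_isConnected.1 ‹_› (G t0 x0)).mem_iff.1 hpb
  have hct : ∀ᶠ t in 𝓝 t0, G t x0 ∈ Y' :=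
    (hc.comp (by fun_prop : Continuous fun t : T => (t, x0))).continuousAt (hYo.mem_nhds hY0)
  have key : ∀ᶠ p : T × Y in 𝓝 (t0, G t0 x0), (p.1 ∈ A ∧ pa p.1 ∧ G p.1 x0 ∈ Y') ∧ p.2 ∈ Y' := by
    rw [nhds_prod_eq]
    exact (Filter.Eventually.and hA (hpa.and hct)).prod_mk (hYo.mem_nhds hY0)
  filter_upwards [key]
  rintro ⟨t, y⟩ ⟨⟨htA, hta, htx⟩, hy⟩
  have hsub : Y' ⊆ G t '' O := by
    apply hYc.isPreconnected.subset_of_closure_inter_subset (ho t _ isOpen_interior)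
      ⟨_, htx, x0, hx0, rfl⟩
    rintro z ⟨hz, hzY⟩
    have hGt : Continuous (G t) := hc.comp (by fun_prop : Continuous fun x : X => (t, x))
    have hcl : IsClosed (G t '' closure O) := (isClosed_closure.isCompact.image hGt).isClosed
    obtain ⟨x, hx, rfl⟩ := (hcl.closure_subset_iff.2 (image_mono subset_closure)) hz
    by_contra hn
    exact hp hta (hY' hzY) x ⟨hx, fun hxO => hn ⟨x, hxO, rfl⟩⟩ rfl
  obtain ⟨x, hx, rfl⟩ := hsub hy
  exact hAB (mk_mem_prod htA (hCB (interior_subset hx)).1)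

structure DegTwoFam {T X Y : Type*} [TopologicalSpace T] [TopologicalSpace X] [TopologicalSpace Y]
    (G : T → X → Y) : Prop where
  cont : Continuous fun p : T × X => G p.1 p.2
  op : IsOpenMap fun p : T × X => (p.1, G p.1 p.2)
  fib : ∀ t y, ∃ x x', G t ⁻¹' {y} = {x, x'}

namespace DegTwoFam
variable {T X Y : Type*} [TopologicalSpace T] [TopologicalSpace X] [TopologicalSpace Y]
  {G : T → X → Y}

theorem cont' (h : DegTwoFam G) : Continuous fun p : T × X => (p.1, G p.1 p.2) :=
  continuous_fst.prodMk h.cont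

theorem two (h : DegTwoFam G) {t : T} {a b c : X} (hab : G t a = G t b) (hac : G t a = G t c) :
    a = b ∨ a = c ∨ b = c := by
  obtain ⟨x, x', hx⟩ := h.fib t (G t a)
  have ha : a ∈ ({x, x'} : Set X) := hx ▸ rfl
  have hb : b ∈ ({x, x'} : Set X) := hx ▸ hab.symm
  have hc : c ∈ ({x, x'} : Set X) := hx ▸ hac.symm
  simp only [mem_insert_iff, mem_singleton_iff] at ha hb hc
  grind

theorem near (h : DegTwoFam G) {t0 : T} {x1 x2 : X} (he : G t0 x1 = G t0 x2) {N : Set X}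
    (hN : N ∈ 𝓝 x2) : ∀ᶠ p : T × X in 𝓝 (t0, x1), ∃ x' ∈ N, G p.1 x' = G p.1 p.2 := by
  have h1 : (fun p : T × X => (p.1, G p.1 p.2)) '' (univ ×ˢ N) ∈ 𝓝 (t0, G t0 x1) := by
    rw [he]
    exact h.op.image_mem_nhds (x := (t0, x2)) (prod_mem_nhds univ_mem hN)
  have h2 := h.cont'.continuousAt (x := (t0, x1)) h1
  filter_upwards [h2]
  rintro ⟨t, x⟩ ⟨⟨t', x'⟩, ⟨-, hx'⟩, he'⟩
  simp only [Prod.mk.injEq] at he'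
  obtain ⟨rfl, he'⟩ := he'
  exact ⟨x', hx', he'⟩

theorem near_inj [T2Space X] (h : DegTwoFam G) {t0 : T} {x1 x2 : X} (he : G t0 x1 = G t0 x2)
    (hne : x1 ≠ x2) : ∃ U : Set (T × X), IsOpen U ∧ (t0, x1) ∈ U ∧
      InjOn (fun p : T × X => (p.1, G p.1 p.2)) U := by
  obtain ⟨N1, N2, o1, o2, m1, m2, hd⟩ := t2_separation hne
  have h1 := h.near he (o2.mem_nhds m2)
  have h2 : ∀ᶠ p : T × X in 𝓝 (t0, x1), p.2 ∈ N1 :=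
    continuous_snd.continuousAt (o1.mem_nhds m1)
  obtain ⟨U, hU, hUo, hm⟩ := eventually_nhds_iff.1 (h1.and h2)
  refine ⟨U, hUo, hm, ?_⟩
  rintro ⟨t, a⟩ ha ⟨t', b⟩ hb hab
  simp only [Prod.mk.injEq] at hab
  obtain ⟨rfl, hab⟩ := hab
  obtain ⟨⟨c, hc, hca⟩, ha1⟩ := hU _ ha
  obtain ⟨-, hb1⟩ := hU _ hb
  simp only at hca ha1 hb1
  have hac : a ≠ c := fun e => disjoint_left.1 hd ha1 (e ▸ hc)
  have hbc : b ≠ c := fun e => disjoint_left.1 hd hb1 (e ▸ hc)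
  have := h.two hab hca.symm
  simp [hac, hbc] at this
  rw [this]

end DegTwoFam

theorem lift_family {X : Type*} [TopologicalSpace X] [CompactSpace X] [T2Space X]
    (G : unitInterval → X → X) (hG : DegTwoFam G) (V : Set X) (hVc : IsClosed V)
    (hV : ∀ s y, y ∈ V ↔ ∃ x, G s ⁻¹' {y} = {x}) :
    ∃ ψ : unitInterval × X → X, Continuous ψ ∧ (∀ x, ψ (0, x) = x) ∧
      (∀ s, Function.Bijective fun x => ψ (s, x)) ∧ (∀ s x, G s (ψ (s, x)) = G 0 x) ∧
      ∀ p : unitInterval → X, Continuous p → (∀ s, G s (p s) = G 0 (p 0)) →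
        ∀ s, ψ (s, p 0) = p s := by
  classical
  let Φ : unitInterval × X → unitInterval × X := fun p => (p.1, G p.1 p.2)
  let S : Set (unitInterval × X) := {b | b.2 ∉ V}
  have hcov : IsCoveringMapOn Φ S := by
    apply IsCoveringMapOn.of_isLocalHomeomorphOn hG.cont'
    rw [isLocalHomeomorphOn_iff_isOpenEmbedding_restrict]
    rintro ⟨t, x⟩ hx
    have : ∃ x2, G t x = G t x2 ∧ x ≠ x2 := by
      by_contra hcon
      push Not at hcon
      apply hx
      rw [hV t]
      exact ⟨x, Set.ext fun z => ⟨fun hz => (hcon z (Eq.symm hz)).symm, fun hz => by rw [hz]; rfl⟩⟩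
    obtain ⟨x2, he, hne⟩ := this
    obtain ⟨U, hUo, hm, hinj⟩ := hG.near_inj he hne
    refine ⟨U, hUo.mem_nhds hm, ?_⟩
    apply IsOpenEmbedding.of_continuous_injective_isOpenMap
    · exact hG.cont'.comp continuous_subtype_val
    · exact hinj.injective
    · exact hG.op.comp hUo.isOpenMap_subtype_val
  have cov := hcov.isCoveringMap_restrictPreimage
  let A := {x : X // G 0 x ∉ V}
  have hG0 : Continuous (G 0) := hG.cont.comp (by fun_prop : Continuous fun x : X => ((0 : unitInterval), x))
  have hAo : IsOpen {x : X | G 0 x ∉ V} := hVc.isOpen_compl.preimage hG0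
  let H : C(unitInterval × A, S) := ⟨fun p => ⟨(p.1, G 0 p.2.1), p.2.2⟩, by
    refine Continuous.subtype_mk ?_ _
    exact continuous_fst.prodMk (hG0.comp (continuous_subtype_val.comp continuous_snd))⟩
  let f : C(A, Φ ⁻¹' S) := ⟨fun a => ⟨(0, a.1), a.2⟩, by
    refine Continuous.subtype_mk ?_ _
    exact continuous_const.prodMk continuous_subtype_val⟩
  have H0 : ∀ a, H (0, a) = S.restrictPreimage Φ (f a) := fun a => rfl
  let L := cov.liftHomotopy H f H0
  have hL : ∀ p, Φ (L p).1 = (p.1, G 0 p.2.1) := fun p =>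
    congrArg Subtype.val (congrFun (cov.liftHomotopy_lifts H f H0) p)
  have hL1 : ∀ p, (L p).1.1 = p.1 := fun p => congrArg Prod.fst (hL p)
  have hL2 : ∀ p, G p.1 (L p).1.2 = G 0 p.2.1 := fun p => by
    have := congrArg Prod.snd (hL p)
    simp only [Φ, hL1] at this
    exact this
  have hL0 : ∀ a : A, (L (0, a)).1.2 = a.1 := fun a => by
    have := cov.liftHomotopy_zero H f H0 a
    simp only [L, this]; rfl
  have hz : ∀ s y, y ∈ V → ∃ x, G s ⁻¹' {y} = {x} := fun s y hy => (hV s y).1 hy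
  choose! c hc using hz
  have hcG : ∀ s y, y ∈ V → G s (c s y) = y := fun s y hy => by
    have : c s y ∈ G s ⁻¹' {y} := by rw [hc s y hy]; rfl
    exact this
  have hcu : ∀ s x, G s x ∈ V → x = c s (G s x) := fun s x hx => by
    have : x ∈ G s ⁻¹' {G s x} := rfl
    rw [hc s _ hx] at this
    exact this
  let ψ : unitInterval × X → X := fun p =>
    if h : G 0 p.2 ∉ V then (L (p.1, ⟨p.2, h⟩)).1.2 else c p.1 (G 0 p.2)
  have hψG : ∀ s x, G s (ψ (s, x)) = G 0 x := by
    intro s x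
    by_cases h : G 0 x ∈ V
    · simp only [ψ, h, not_true, dite_false]; exact hcG s _ h
    · simp only [ψ, h, not_false_iff, dite_true]; exact hL2 (s, ⟨x, h⟩)
  have hψ0 : ∀ x, ψ (0, x) = x := by
    intro x
    by_cases h : G 0 x ∈ V
    · simp only [ψ, h, not_true, dite_false]; exact (hcu 0 x h).symm
    · simp only [ψ, h, not_false_iff, dite_true]; exact hL0 ⟨x, h⟩
  have hψc : Continuous ψ := by
    rw [continuous_iff_continuousAt]
    rintro ⟨s, x⟩
    by_cases h : G 0 x ∈ V
    · have h1 : Tendsto (fun p : unitInterval × X => (p.1, ψ p)) (𝓝 (s, x)) (𝓝 (s, ψ (s, x))) := by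
        apply tendsto_of_unique (Φ := Φ) hG.cont'
        · rintro ⟨s', z⟩ hz
          simp only [Φ, Prod.mk.injEq] at hz
          obtain ⟨rfl, hz⟩ := hz
          rw [hψG] at hz
          have h2 := hcu s' z (hz ▸ h)
          have h3 := hcu s' (ψ (s', x)) (by rw [hψG]; exact h)
          rw [hψG, ← hz, ← h2] at h3
          rw [h3]
        · have h2 : Continuous (Φ ∘ fun p : unitInterval × X => (p.1, ψ p)) := by
            have : (Φ ∘ fun p : unitInterval × X => (p.1, ψ p)) = fun p => (p.1, G 0 p.2) := by
              funext p
              simp only [Φ, Function.comp, Prod.mk.injEq, true_and]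
              exact hψG p.1 p.2
            rw [this]
            fun_prop
          exact h2.tendsto (s, x)
      exact (continuous_snd.tendsto _).comp h1
    · have hoe : IsOpenEmbedding (Prod.map id Subtype.val : unitInterval × A → unitInterval × X) :=
        IsOpenEmbedding.id.prodMap hAo.isOpenEmbedding_subtypeVal
      have : ContinuousAt (ψ ∘ Prod.map id Subtype.val) ((s, ⟨x, h⟩) : unitInterval × A) := by
        have h2 : (ψ ∘ Prod.map id Subtype.val : unitInterval × A → X) = fun p => (L p).1.2 := by
          funext p
          simp only [ψ, Function.comp, Prod.map, id]
          rw [dif_pos p.2.2]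
        rw [h2]
        exact Continuous.continuousAt (by fun_prop)
      exact (hoe.continuousAt_iff (x := ((s, ⟨x, h⟩) : unitInterval × A))).1 this
  have huniq : ∀ p q : unitInterval → X, Continuous p → Continuous q → ∀ y,
      (∀ s, G s (p s) = y) → (∀ s, G s (q s) = y) → ∀ s, p s = q s → ∀ s', p s' = q s' := by
    intro p q hp hq y hpy hqy s hs s'
    by_cases h : y ∈ V
    · have h1 := hcu s' (p s') (by rw [hpy]; exact h)
      have h2 := hcu s' (q s') (by rw [hqy]; exact h)
      rw [hpy] at h1; rw [hqy] at h2
      rw [h1, h2]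
    · have e1 : ∀ s, (s, p s) ∈ Φ ⁻¹' S := fun s => by
        show G s (p s) ∉ V
        rw [hpy]; exact h
      have e2 : ∀ s, (s, q s) ∈ Φ ⁻¹' S := fun s => by
        show G s (q s) ∉ V
        rw [hqy]; exact h
      have := cov.eq_of_comp_eq (A := unitInterval)
        (g₁ := fun s => ⟨(s, p s), e1 s⟩)
        (g₂ := fun s => ⟨(s, q s), e2 s⟩)
        (Continuous.subtype_mk (by fun_prop) e1) (Continuous.subtype_mk (by fun_prop) e2)
        (by
          funext s
          apply Subtype.ext
          show (s, G s (p s)) = (s, G s (q s))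
          rw [hpy, hqy]) s (by simp only [hs])
      exact congrArg (fun e => e.1.2) (congrFun this s')
  have hψs : ∀ x, Continuous fun s => ψ (s, x) := fun x => hψc.comp (by fun_prop)
  have hinj : ∀ s, Function.Injective fun x => ψ (s, x) := by
    intro s x x' hxx
    have h1 : G 0 x = G 0 x' := by
      rw [← hψG s x, ← hψG s x']; exact congrArg _ hxx
    have := huniq (fun s => ψ (s, x)) (fun s => ψ (s, x')) (hψs x) (hψs x') (G 0 x)
      (fun s => hψG s x) (fun s => by rw [hψG, h1]) s hxx 0
    simpa [hψ0] using this
  refine ⟨ψ, hψc, hψ0, fun s => ⟨hinj s, ?_⟩, hψG, ?_⟩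
  · intro z
    obtain ⟨a, b, hab⟩ := hG.fib 0 (G s z)
    have ha : G 0 a = G s z := by
      have : a ∈ G 0 ⁻¹' {G s z} := by rw [hab]; simp
      exact this
    have hb : G 0 b = G s z := by
      have : b ∈ G 0 ⁻¹' {G s z} := by rw [hab]; simp
      exact this
    by_cases h : G s z ∈ V
    · refine ⟨a, ?_⟩
      have h2 := hcu s z h
      have h3 := hcu s (ψ (s, a)) (by rw [hψG, ha]; exact h)
      rw [hψG, ha, ← h2] at h3
      exact h3
    · have hne : a ≠ b := by
        rintro rfl
        apply h
        rw [hV 0]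
        exact ⟨a, by simpa using hab⟩
      have := hG.two (t := s) (a := ψ (s, a)) (b := ψ (s, b)) (c := z)
        (by rw [hψG, hψG, ha, hb]) (by rw [hψG, ha])
      rcases this with h1 | h1 | h1
      · exact absurd (hinj s h1) hne
      · exact ⟨a, h1⟩
      · exact ⟨b, h1⟩
  · intro p hp hpG s
    exact huniq (fun s => ψ (s, p 0)) p (hψs _) hp (G 0 (p 0)) (fun s => hψG s _) hpG 0 (hψ0 _) s

instance sph_lc : LocallyConnectedSpace Sph :=
  ChartedSpace.locallyConnectedSpace (EuclideanSpace ℝ (Fin 2)) _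

instance sph_conn : ConnectedSpace Sph := by
  apply isConnected_iff_connectedSpace.1
  apply isConnected_sphere _ _ zero_le_one
  rw [← Module.finrank_eq_rank, finrank_euclideanSpace]
  norm_num

instance sph_nontriv : Nontrivial Sph := by
  refine ⟨⟨EuclideanSpace.single 0 1, by simp⟩, ⟨EuclideanSpace.single 1 1, by simp⟩, ?_⟩
  intro h
  have := congrArg (fun v : EuclideanSpace ℝ (Fin 3) => v 0) (congrArg Subtype.val h)
  simp at this

theorem roots_lemma {k : ℕ} (hk : 0 < k) {r : ℝ} (hr : 0 < r) {w : ℂ} (hw : w ≠ 0)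
    (hwr : ‖w‖ < r ^ k) : ∃ g : Fin k → ℂ, Function.Injective g ∧ ∀ i, ‖g i‖ < r ∧ g i ^ k = w := by
  obtain ⟨w0, h0⟩ := IsAlgClosed.exists_pow_nat_eq w hk
  have hζ := Complex.isPrimitiveRoot_exp k hk.ne'
  set ζ := Complex.exp (2 * Real.pi * Complex.I / k)
  have hw0 : w0 ≠ 0 := by
    rintro rfl
    rw [zero_pow hk.ne'] at h0
    exact hw h0.symm
  refine ⟨fun i => w0 * ζ ^ (i : ℕ), ?_, fun i => ⟨?_, ?_⟩⟩
  · intro i j hij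
    have := mul_left_cancel₀ hw0 hij
    exact Fin.ext (hζ.pow_inj i.2 j.2 this)
  · have h1 : ‖ζ‖ = 1 := Complex.norm_eq_one_of_pow_eq_one hζ.pow_eq_one hk.ne'
    rw [norm_mul, norm_pow, h1, one_pow, mul_one]
    rw [← h0, norm_pow] at hwr
    exact lt_of_pow_lt_pow_left₀ k hr.le hwr
  · rw [mul_pow, ← pow_mul, mul_comm (i : ℕ), pow_mul, hζ.pow_eq_one, one_pow, mul_one, h0]

theorem ram_near {f : Sph → Sph} {x : Sph} {k : ℕ} (h : IsRamifiedAt f x k) {N : Set Sph}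
    (hN : N ∈ 𝓝 x) : ∀ᶠ y in 𝓝[≠] (f x), ∃ g : Fin k → Sph, Function.Injective g ∧
      ∀ i, g i ∈ N ∧ f (g i) = y := by
  obtain ⟨hk, U, V, hx, hfx, hmap, hU, hV, φ, ψ, hφ, hψ, hz⟩ := h
  have hd0 : (0 : ℂ) ∈ unitDisk := by simp [unitDisk]
  have e0 : φ.symm ⟨0, hd0⟩ = ⟨x, hx⟩ := by
    rw [φ.symm_apply_eq]; exact Subtype.ext hφ.symm
  have h1 : ∀ᶠ d : unitDisk in 𝓝 ⟨0, hd0⟩, (φ.symm d : Sph) ∈ N := by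
    have hc : Continuous fun d => (φ.symm d : Sph) := by fun_prop
    apply hc.continuousAt
    show N ∈ 𝓝 ((φ.symm ⟨0, hd0⟩ : U) : Sph)
    rw [e0]; exact hN
  obtain ⟨r0, hr0, hball⟩ := Metric.eventually_nhds_iff.1 h1
  let r := min r0 1
  have hr : 0 < r := lt_min hr0 one_pos
  have h2 : ∀ᶠ y : V in 𝓝 ⟨f x, hfx⟩, ‖(ψ y : ℂ)‖ < r ^ k := by
    have hc : Continuous fun y => ‖(ψ y : ℂ)‖ := by fun_prop
    apply hc.continuousAt.eventually_lt_const
    show ‖(ψ ⟨f x, hfx⟩ : ℂ)‖ < r ^ k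
    rw [hψ, norm_zero]; positivity
  have h3 : ∀ᶠ y in 𝓝 (f x), ∃ h : y ∈ V, ‖(ψ ⟨y, h⟩ : ℂ)‖ < r ^ k := by
    rw [nhds_subtype_eq_comap, ] at h2
    have := (hV.isOpenEmbedding_subtypeVal.map_nhds_eq ⟨f x, hfx⟩)
    rw [← this, eventually_map, nhds_subtype_eq_comap]
    filter_upwards [h2] with y hy
    exact ⟨y.2, hy⟩
  filter_upwards [h3.filter_mono nhdsWithin_le_nhds, self_mem_nhdsWithin]
  rintro y ⟨hyV, hy⟩ hne
  have hw : (ψ ⟨y, hyV⟩ : ℂ) ≠ 0 := by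
    intro h0
    apply hne
    have : ψ ⟨y, hyV⟩ = ψ ⟨f x, hfx⟩ := Subtype.ext (h0.trans hψ.symm)
    exact congrArg Subtype.val (ψ.injective this)
  obtain ⟨g, hg, hgi⟩ := roots_lemma hk hr hw hy
  have hgd : ∀ i, g i ∈ unitDisk := fun i => by
    simp only [unitDisk, mem_ball_zero_iff]
    exact (hgi i).1.trans_le (min_le_right _ _)
  refine ⟨fun i => (φ.symm ⟨g i, hgd i⟩ : Sph), ?_, fun i => ⟨?_, ?_⟩⟩
  · intro i j hij
    have := φ.symm.injective (Subtype.ext hij)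
    exact hg (congrArg Subtype.val this)
  · apply hball
    rw [Subtype.dist_eq, dist_zero_right]
    exact (hgi i).1.trans_le (min_le_left _ _)
  · have := hz (φ.symm ⟨g i, hgd i⟩)
    rw [φ.apply_symm_apply] at this
    have h5 : ψ ⟨f (φ.symm ⟨g i, hgd i⟩), hmap (φ.symm ⟨g i, hgd i⟩).2⟩ = ψ ⟨y, hyV⟩ :=
      Subtype.ext (this.trans (hgi i).2)
    exact congrArg Subtype.val (ψ.injective h5)

theorem ram_open {f : Sph → Sph} (h : IsRamifiedCovering f) : IsOpenMap f := by
  rw [isOpenMap_iff_nhds_le]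
  intro x N hN
  obtain ⟨k, hk⟩ := h.2 x
  have h1 := ram_near hk hN
  rw [eventually_nhdsWithin_iff] at h1
  filter_upwards [h1] with y hy
  by_cases hyx : y = f x
  · rw [hyx]; exact mem_of_mem_nhds (x := x) hN
  · obtain ⟨g, -, hg⟩ := hy hyx
    have := hg ⟨0, hk.1⟩
    rw [← this.2]; exact this.1

section single
variable {F : Sph → Sph} (hT : IsThurstonMap F) (hD : HasDegreeTwo F)
include hT hD

theorem critval_finite : {y | IsCriticalValue F y}.Finite := by
  refine hT.2.subset ?_
  rintro y ⟨x, hx, rfl⟩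
  simp only [postCritical, mem_iUnion]
  exact ⟨1, le_refl 1, x, hx, rfl⟩

theorem noncrit_near (y : Sph) : ∀ᶠ z in 𝓝[≠] y, ¬ IsCriticalValue F z := by
  have h1 : IsClosed ({y | IsCriticalValue F y} \ {y}) := ((critval_finite hT hD).sdiff).isClosed
  have h2 : ({y | IsCriticalValue F y} \ {y})ᶜ ∈ 𝓝 y := h1.isOpen_compl.mem_nhds (by simp)
  rw [eventually_nhdsWithin_iff]
  filter_upwards [h2] with z hz hzy hc
  exact hz ⟨hc, hzy⟩

theorem fib_card {y : Sph} (hy : ¬ IsCriticalValue F y) {α : Type} [Finite α] {g : α → Sph}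
    (hg : Function.Injective g) (hgy : ∀ i, F (g i) = y) : Nat.card α ≤ 2 := by
  rw [← hD y hy]
  have : Finite (F ⁻¹' {y} : Set Sph) := Nat.finite_of_card_ne_zero (by rw [hD y hy]; norm_num)
  exact Nat.card_le_card_of_injective (fun i => (⟨g i, hgy i⟩ : (F ⁻¹' {y} : Set Sph)))
    fun i j hij => hg (congrArg Subtype.val hij)

theorem ram_le_two {x : Sph} {k : ℕ} (h : IsRamifiedAt F x k) : k ≤ 2 := by
  obtain ⟨y, ⟨g, hg, hgy⟩, hy⟩ := ((ram_near h univ_mem).and (noncrit_near hT hD (F x))).exists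
  simpa using fib_card hT hD hy hg fun i => (hgy i).2

theorem crit_unique {x x' : Sph} (h : IsCriticalPt F x) (he : F x' = F x) : x' = x := by
  by_contra hne
  obtain ⟨k, hk, h⟩ := h
  obtain ⟨k', h'⟩ := hT.1.2 x'
  obtain ⟨N1, N2, o1, o2, m1, m2, hd⟩ := t2_separation hne
  have e1 := ram_near h (o2.mem_nhds m2)
  have e2 := ram_near h' (o1.mem_nhds m1)
  rw [he] at e2
  obtain ⟨y, ⟨⟨g, hg, hgy⟩, ⟨g', hg', hgy'⟩⟩, hy⟩ :=
    ((e1.and e2).and (noncrit_near hT hD (F x))).exists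
  have := fib_card hT hD hy (g := Sum.elim g g') (by
    apply hg.sumElim hg'
    intro a b hab
    exact disjoint_left.1 hd (hgy' b).1 (hab ▸ (hgy a).1)) (by
    rintro (i | i)
    · exact (hgy i).2
    · exact (hgy' i).2)
  simp at this
  have := h'.1
  omega

theorem fib_two (y : Sph) : ∃ x x', F ⁻¹' {y} = {x, x'} ∧ (IsCriticalValue F y ↔ x = x') := by
  by_cases hy : IsCriticalValue F y
  · obtain ⟨x, hx, rfl⟩ := hy
    refine ⟨x, x, ?_, by simp; exact ⟨x, hx, rfl⟩⟩
    ext z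
    simp only [mem_preimage, mem_singleton_iff, mem_insert_iff, or_self]
    exact ⟨fun h => crit_unique hT hD hx h, fun h => by rw [h]⟩
  · have := hD y hy
    rw [Nat.card_coe_set_eq, ncard_eq_two] at this
    obtain ⟨a, b, hab, h⟩ := this
    exact ⟨a, b, h, by simp [hy, hab]⟩

theorem critval_iff (y : Sph) : IsCriticalValue F y ↔ ∃ x, F ⁻¹' {y} = {x} := by
  obtain ⟨a, b, hab, h⟩ := fib_two hT hD y
  rw [h, hab]
  constructor
  · rintro rfl
    exact ⟨a, by simp⟩
  · rintro ⟨x, hx⟩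
    have h1 : a ∈ ({x} : Set Sph) := by rw [← hx]; simp
    have h2 : b ∈ ({x} : Set Sph) := by rw [← hx]; simp
    simp only [mem_singleton_iff] at h1 h2
    rw [h1, h2]

theorem crit_iff (x : Sph) : IsCriticalPt F x ↔ ∀ x', F x' = F x → x' = x := by
  constructor
  · exact fun h x' => crit_unique hT hD h
  · intro h
    have : IsCriticalValue F (F x) := by
      rw [critval_iff hT hD]
      exact ⟨x, Set.ext fun z => ⟨fun hz => h z hz, fun hz => by rw [hz]; rfl⟩⟩
    obtain ⟨c, hc, he⟩ := this
    rw [← h c he]; exact hc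

theorem crit_chart {c : Sph} (h : IsCriticalPt F c) : ∃ (U : Set Sph) (hc : c ∈ U)
    (φ : U ≃ₜ unitDisk), IsOpen U ∧ (φ ⟨c, hc⟩ : ℂ) = 0 ∧
      ∀ z z' : U, (φ z' : ℂ) = - φ z → F z' = F z := by
  obtain ⟨k, hk, h⟩ := h
  obtain rfl : k = 2 := le_antisymm (ram_le_two hT hD h) hk
  obtain ⟨-, U, V, hx, hfx, hmap, hU, hV, φ, ψ, hφ, hψ, hz⟩ := h
  refine ⟨U, hx, φ, hU, hφ, fun z z' hzz => ?_⟩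
  have : ψ ⟨F z', hmap z'.2⟩ = ψ ⟨F z, hmap z.2⟩ := Subtype.ext (by
    rw [hz, hz, hzz, neg_sq])
  exact congrArg Subtype.val (ψ.injective this)

end single

theorem degTwo_of {T : Type*} [TopologicalSpace T] {F : T → Sph → Sph}
    (hcont : Continuous fun p : T × Sph => F p.1 p.2)
    (hT : ∀ t, IsThurstonMap (F t)) (hD : ∀ t, HasDegreeTwo (F t)) : DegTwoFam F where
  cont := hcont
  op := by
    apply open_family hcont (fun t => ram_open (hT t).1)
    intro t y
    obtain ⟨a, b, h, -⟩ := fib_two (hT t) (hD t) y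
    rw [h]; exact toFinite _
  fib t y := by
    obtain ⟨a, b, h, -⟩ := fib_two (hT t) (hD t) y
    exact ⟨a, b, h⟩

theorem crit_chart' {F : Sph → Sph} (hT : IsThurstonMap F) (hD : HasDegreeTwo F)
    {c : Sph} (h : IsCriticalPt F c) : ∃ (U : Set Sph) (φ : Sph → ℂ) (ρ : ℂ → Sph),
      IsOpen U ∧ c ∈ U ∧ ContinuousOn φ U ∧ ContinuousOn ρ unitDisk ∧ MapsTo ρ unitDisk U ∧
      (∀ w ∈ unitDisk, φ (ρ w) = w) ∧ (∀ x ∈ U, ρ (φ x) = x) ∧ ρ 0 = c ∧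
      ∀ w ∈ unitDisk, F (ρ (-w)) = F (ρ w) := by
  classical
  obtain ⟨U, hc, φ, hU, h0, hneg⟩ := crit_chart hT hD h
  have hd0 : (0 : ℂ) ∈ unitDisk := by simp [unitDisk]
  have hdn : ∀ w ∈ unitDisk, -w ∈ unitDisk := by simp [unitDisk]
  let φ' : Sph → ℂ := fun x => if h : x ∈ U then φ ⟨x, h⟩ else 0
  let ρ : ℂ → Sph := fun w => if h : w ∈ unitDisk then φ.symm ⟨w, h⟩ else c
  have hφ : ∀ x (h : x ∈ U), φ' x = φ ⟨x, h⟩ := fun x h => by simp only [φ', h, dite_true]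
  have hρ : ∀ x (h : x ∈ unitDisk), ρ x = φ.symm ⟨x, h⟩ := fun x h => by
    simp only [ρ, h, dite_true]
  refine ⟨U, φ', ρ, hU, hc, ?_, ?_, ?_, ?_, ?_, ?_, ?_⟩
  · rw [continuousOn_iff_continuous_restrict]
    have : U.domRestrict φ' = fun x => (φ x : ℂ) := funext fun x => hφ x.1 x.2
    rw [this]; fun_prop
  · rw [continuousOn_iff_continuous_restrict]
    have : unitDisk.domRestrict ρ = fun x => (φ.symm x : Sph) := funext fun x => hρ x.1 x.2
    rw [this]; fun_prop
  · intro w hw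
    rw [hρ w hw]; exact (φ.symm ⟨w, hw⟩).2
  · intro w hw
    rw [hρ w hw, hφ _ (φ.symm ⟨w, hw⟩).2]
    simp
  · intro x hx
    rw [hφ x hx, hρ _ (φ ⟨x, hx⟩).2]
    simp
  · rw [hρ 0 hd0]
    have : φ.symm ⟨0, hd0⟩ = ⟨c, hc⟩ := by
      rw [φ.symm_apply_eq]; exact Subtype.ext h0.symm
    rw [this]
  · intro w hw
    rw [hρ w hw, hρ _ (hdn w hw)]
    apply hneg
    simp

section fam
variable {F : unitInterval → Sph → Sph}
    (hcont : Continuous fun p : unitInterval × Sph => F p.1 p.2)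
    (hT : ∀ t, IsThurstonMap (F t))
    (hD : ∀ t, HasDegreeTwo (F t))
include hcont hT hD

theorem exists_sigma : ∃ σ : unitInterval × Sph → Sph, Continuous σ ∧
    (∀ t x, F t (σ (t, x)) = F t x) ∧ (∀ t x z, F t z = F t x → z = x ∨ z = σ (t, x)) := by
  have hG := degTwo_of hcont hT hD
  have h1 : ∀ p : unitInterval × Sph, ∃ x', F p.1 x' = F p.1 p.2 ∧
      ∀ z, F p.1 z = F p.1 p.2 → z = p.2 ∨ z = x' := by
    rintro ⟨t, x⟩
    obtain ⟨a, b, hab⟩ := hG.fib t (F t x)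
    have key : ∀ z, F t z = F t x ↔ z = a ∨ z = b := fun z => by
      have : z ∈ F t ⁻¹' {F t x} ↔ z ∈ ({a, b} : Set Sph) := by rw [hab]
      simpa using this
    rcases (key x).1 rfl with h | h
    · exact ⟨b, (key b).2 (Or.inr rfl), fun z hz => by simpa [h] using (key z).1 hz⟩
    · exact ⟨a, (key a).2 (Or.inl rfl), fun z hz => by simpa [h] using ((key z).1 hz).symm⟩
  choose σ hσ1 hσ2 using h1
  refine ⟨σ, ?_, fun t x => hσ1 (t, x), fun t x => hσ2 (t, x)⟩
  rw [continuous_iff_continuousAt]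
  rintro ⟨t0, x0⟩
  by_cases h : σ (t0, x0) = x0
  · have h1 : Tendsto (fun p : unitInterval × Sph => (p.1, σ p)) (𝓝 (t0, x0)) (𝓝 (t0, x0)) := by
      apply tendsto_of_unique hG.cont'
      · rintro ⟨t, z⟩ hz
        simp only [Prod.mk.injEq] at hz
        obtain ⟨rfl, hz⟩ := hz
        rcases hσ2 (t, x0) z hz with h2 | h2
        · rw [h2]
        · rw [h2, h]
      · have : ((fun p : unitInterval × Sph => (p.1, F p.1 p.2)) ∘
            fun p : unitInterval × Sph => (p.1, σ p)) = fun p => (p.1, F p.1 p.2) := by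
          funext p
          simp only [Function.comp, hσ1]
        rw [this]
        exact hG.cont'.tendsto (t0, x0)
    have := (continuous_snd.tendsto _).comp h1
    unfold ContinuousAt
    rw [h]; exact this
  · intro N hN
    obtain ⟨N1, N2, o1, o2, m1, m2, hd⟩ := t2_separation h
    have e1 := hG.near (hσ1 (t0, x0)).symm (inter_mem hN (o1.mem_nhds m1))
    have e2 : ∀ᶠ p : unitInterval × Sph in 𝓝 (t0, x0), p.2 ∈ N2 :=
      continuous_snd.continuousAt (o2.mem_nhds m2)
    rw [mem_map]
    filter_upwards [e1, e2]
    rintro p ⟨x', ⟨hN', hN1⟩, he⟩ hp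
    rcases hσ2 p x' he with h3 | h3
    · exact absurd hp (disjoint_left.1 hd (h3 ▸ hN1))
    · show σ p ∈ N
      rw [← h3]; exact hN'

theorem crit_persist {t0 : unitInterval} {c : Sph} (h : IsCriticalPt (F t0) c) {N : Set Sph}
    (hN : N ∈ 𝓝 c) : ∀ᶠ t in 𝓝 t0, ∃ x ∈ N, IsCriticalPt (F t) x := by
  obtain ⟨σ, hσc, hσ1, hσ2⟩ := exists_sigma hcont hT hD
  obtain ⟨U, φ, ρ, hU, hcU, hφc, hρc, hρm, hφρ, hρφ, hρ0, hneg⟩ := crit_chart' (hT t0) (hD t0) h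
  have hDo : IsOpen unitDisk := Metric.isOpen_ball
  have hd0 : (0 : ℂ) ∈ unitDisk := by simp [unitDisk]
  have hdn : ∀ w ∈ unitDisk, -w ∈ unitDisk := by simp [unitDisk]
  have e1 : ∀ᶠ w in 𝓝 (0 : ℂ), w ∈ unitDisk ∧ ρ w ∈ N := by
    refine Filter.Eventually.and (hDo.mem_nhds hd0) ?_
    apply hρc.continuousAt (hDo.mem_nhds hd0)
    rw [hρ0]; exact hN
  obtain ⟨r, hr, hball⟩ := Metric.nhds_basis_closedBall.eventually_iff.1 e1
  have hσ0 : ∀ w ∈ unitDisk, σ (t0, ρ w) = ρ (-w) := by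
    intro w hw
    rcases hσ2 t0 (ρ w) _ (hneg w hw) with h1 | h1
    · have := congrArg φ h1
      rw [hφρ _ hw, hφρ _ (hdn w hw)] at this
      have hw0 : w = 0 := by
        have h3 : (2 : ℂ) * w = 0 := by linear_combination -this
        simpa using h3
      rw [hw0, neg_zero, hρ0]
      exact crit_unique (hT t0) (hD t0) h (hσ1 t0 c)
    · exact h1.symm
  have e2 : ∀ᶠ t in 𝓝 t0, ∀ w ∈ Metric.closedBall (0 : ℂ) r,
      σ (t, ρ w) ∈ U ∧ ‖φ (σ (t, ρ w)) + w‖ < r := by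
    apply (isCompact_closedBall (0 : ℂ) r).eventually_forall_of_forall_eventually
    intro w hw
    have hw' := (hball hw).1
    have hcρ : ContinuousAt ρ w := hρc.continuousAt (hDo.mem_nhds hw')
    have hc1 : ContinuousAt (fun z : unitInterval × ℂ => σ (z.1, ρ z.2)) (t0, w) := by
      apply hσc.continuousAt.comp
      exact continuousAt_fst.prodMk (ContinuousAt.comp (x := ((t0, w) : unitInterval × ℂ)) hcρ
        continuousAt_snd)
    have hmU : σ (t0, ρ w) ∈ U := by rw [hσ0 w hw']; exact hρm (hdn w hw')
    refine Filter.Eventually.and (hc1 (hU.mem_nhds hmU)) ?_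
    have hc2 : ContinuousAt (fun z : unitInterval × ℂ => ‖φ (σ (z.1, ρ z.2)) + z.2‖) (t0, w) := by
      apply ContinuousAt.norm
      apply ContinuousAt.add _ continuousAt_snd
      exact ContinuousAt.comp (x := ((t0, w) : unitInterval × ℂ))
        (hφc.continuousAt (hU.mem_nhds hmU)) hc1
    apply hc2.eventually_lt_const
    show ‖φ (σ (t0, ρ w)) + w‖ < r
    rw [hσ0 w hw', hφρ _ (hdn w hw')]
    simpa using hr
  filter_upwards [e2] with t ht
  obtain ⟨w, hw, hw0⟩ := zero_lemma hr (fun w => (w - φ (σ (t, ρ w))) / 2) (by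
    have hcρ : ContinuousOn ρ (Metric.closedBall 0 r) := hρc.mono fun w hw => (hball hw).1
    have hcs : ContinuousOn (fun w => σ (t, ρ w)) (Metric.closedBall 0 r) :=
      hσc.comp_continuousOn (continuousOn_const.prodMk hcρ)
    have := hφc.comp hcs fun w hw => (ht w hw).1
    exact (continuousOn_id.sub this).div_const 2) (by
    intro z hz
    have h1 := (ht z (by simp [hz])).2
    have : (z - φ (σ (t, ρ z))) / 2 - z = - ((φ (σ (t, ρ z)) + z) / 2) := by ring
    rw [this, norm_neg, norm_div]
    simp only [Complex.norm_ofNat]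
    linarith [norm_nonneg (φ (σ (t, ρ z)) + z)])
  refine ⟨ρ w, (hball hw).2, ?_⟩
  have h1 : φ (σ (t, ρ w)) = w := by
    have : w - φ (σ (t, ρ w)) = 0 := by simpa using hw0
    linear_combination -this
  have h2 : σ (t, ρ w) = ρ w := by
    rw [← hρφ _ (ht w hw).1, h1]
  rw [crit_iff (hT t) (hD t)]
  intro x' hx'
  rcases hσ2 t _ _ hx' with h3 | h3
  · exact h3
  · rw [h3, h2]

omit hT hD in
theorem iter_cont (n : ℕ) : Continuous fun p : unitInterval × Sph => (F p.1)^[n] p.2 := by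
  induction n with
  | zero => exact continuous_snd
  | succ n ih =>
    simp only [Function.iterate_succ_apply']
    exact hcont.comp (continuous_fst.prodMk ih)

theorem lower_hemi {t0 : unitInterval} {p : Sph} (hp : p ∈ postCritical (F t0)) {N : Set Sph}
    (hN : N ∈ 𝓝 p) : ∀ᶠ t in 𝓝 t0, ∃ x ∈ N, x ∈ postCritical (F t) := by
  simp only [postCritical, mem_iUnion] at hp
  obtain ⟨n, hn, c, hc, rfl⟩ := hp
  have h1 := (iter_cont hcont n).continuousAt (x := (t0, c)) hN
  rw [mem_map, mem_nhds_prod_iff] at h1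
  obtain ⟨A, hA, B, hB, hAB⟩ := h1
  filter_upwards [crit_persist hcont hT hD hc hB, hA]
  rintro t ⟨x, hxB, hx⟩ htA
  refine ⟨(F t)^[n] x, hAB (mk_mem_prod htA hxB), ?_⟩
  simp only [postCritical, mem_iUnion]
  exact ⟨n, hn, x, hx, rfl⟩

end fam

theorem post_inv {F : Sph → Sph} {p : Sph} (hp : p ∈ postCritical F) : F p ∈ postCritical F := by
  simp only [postCritical, mem_iUnion] at hp ⊢
  obtain ⟨n, hn, c, hc, rfl⟩ := hp
  exact ⟨n + 1, Nat.le_add_left 1 n, c, hc, Function.iterate_succ_apply' _ _ _⟩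

theorem critval_post {F : Sph → Sph} {p : Sph} (hp : IsCriticalValue F p) : p ∈ postCritical F := by
  obtain ⟨x, hx, rfl⟩ := hp
  simp only [postCritical, mem_iUnion]
  exact ⟨1, le_refl 1, x, hx, rfl⟩

theorem local_motion {F : unitInterval → Sph → Sph}
    (hcont : Continuous fun p : unitInterval × Sph => F p.1 p.2)
    (hT : ∀ t, IsThurstonMap (F t))
    (hD : ∀ t, HasDegreeTwo (F t))
    (hcard : ∀ t t' : unitInterval,
      Nat.card (postCritical (F t)) = Nat.card (postCritical (F t'))) (t0 : unitInterval) :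
    ∃ q : Sph → unitInterval → Sph, (∀ p ∈ postCritical (F t0), q p t0 = p) ∧
      ∀ᶠ t in 𝓝 t0, (∀ p ∈ postCritical (F t0), ContinuousAt (q p) t) ∧
        (fun p => q p t) '' postCritical (F t0) = postCritical (F t) ∧
        (∀ p ∈ postCritical (F t0), F t (q p t) = q (F t0 p) t) ∧
        ∀ p ∈ postCritical (F t0), (IsCriticalValue (F t) (q p t) ↔ IsCriticalValue (F t0) p) := by
  classical
  have hG := degTwo_of hcont hT hD
  have hfin : (postCritical (F t0)).Finite := (hT t0).2
  obtain ⟨U, hU, hdis⟩ := hfin.t2_separation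
  have e0 : ∀ᶠ t in 𝓝 t0, ∀ p ∈ postCritical (F t0), ∃ x ∈ U p, x ∈ postCritical (F t) := by
    rw [eventually_all_finite hfin]
    intro p hp
    exact lower_hemi hcont hT hD hp ((hU p).2.mem_nhds (hU p).1)
  let q : Sph → unitInterval → Sph := fun p t =>
    if h : ∃ x ∈ U p, x ∈ postCritical (F t) then h.choose else p
  have hq : ∀ p t, (∃ x ∈ U p, x ∈ postCritical (F t)) → q p t ∈ U p ∧ q p t ∈ postCritical (F t) := by
    intro p t h
    simp only [q, h, dite_true]
    exact h.choose_spec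
  -- consequences at good parameters
  have himg : ∀ t, (∀ p ∈ postCritical (F t0), ∃ x ∈ U p, x ∈ postCritical (F t)) →
      (fun p => q p t) '' postCritical (F t0) = postCritical (F t) := by
    intro t ht
    apply eq_of_subset_of_ncard_le _ _ (hT t).2
    · rintro _ ⟨p, hp, rfl⟩
      exact (hq p t (ht p hp)).2
    · rw [InjOn.ncard_image]
      · rw [← Nat.card_coe_set_eq, ← Nat.card_coe_set_eq, hcard t t0]
      · intro p hp p' hp' hpp
        by_contra hne
        have hpp : q p t = q p' t := hpp
        exact disjoint_left.1 (hdis hp hp' hne) (hq p t (ht p hp)).1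
          (hpp ▸ (hq p' t (ht p' hp')).1)
  have huni : ∀ t, (∀ p ∈ postCritical (F t0), ∃ x ∈ U p, x ∈ postCritical (F t)) →
      ∀ p ∈ postCritical (F t0), ∀ x ∈ U p, x ∈ postCritical (F t) → x = q p t := by
    intro t ht p hp x hx hxP
    rw [← himg t ht] at hxP
    obtain ⟨p', hp', rfl⟩ := hxP
    by_cases hne : p' = p
    · rw [hne]
    · exact absurd hx (disjoint_left.1 (hdis hp' hp hne) (hq p' t (ht p' hp')).1)
  have hq0 : ∀ p ∈ postCritical (F t0), q p t0 = p := fun p hp =>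
    (huni t0 e0.self_of_nhds p hp p (hU p).1 hp).symm
  have hcontq : ∀ᶠ t in 𝓝 t0, ∀ p ∈ postCritical (F t0), ContinuousAt (q p) t := by
    filter_upwards [e0.eventually_nhds] with t1 ht1 p hp N hN
    have hq1 := hq p t1 (ht1.self_of_nhds p hp)
    rw [mem_map]
    filter_upwards [lower_hemi hcont hT hD hq1.2 (inter_mem hN ((hU p).2.mem_nhds hq1.1)), ht1]
    rintro t ⟨x, ⟨hxN, hxU⟩, hxP⟩ ht
    show q p t ∈ N
    rw [← huni t ht p hp x hxU hxP]; exact hxN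
  refine ⟨q, hq0, ?_⟩
  have hq0c : ∀ p ∈ postCritical (F t0), Tendsto (q p) (𝓝 t0) (𝓝 p) := fun p hp => by
    have := hcontq.self_of_nhds p hp
    unfold ContinuousAt at this
    rwa [hq0 p hp] at this
  have e1 : ∀ᶠ t in 𝓝 t0, ∀ p ∈ postCritical (F t0), F t (q p t) = q (F t0 p) t := by
    rw [eventually_all_finite hfin]
    intro p hp
    have h1 : Tendsto (fun t => F t (q p t)) (𝓝 t0) (𝓝 (F t0 p)) :=
      (hcont.tendsto (t0, p)).comp (tendsto_id.prodMk_nhds (hq0c p hp))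
    filter_upwards [h1 ((hU (F t0 p)).2.mem_nhds (hU (F t0 p)).1), e0] with t ht1 ht
    exact huni t ht _ (post_inv hp) _ ht1 (post_inv (hq p t (ht p hp)).2)
  have e2 : ∀ᶠ t in 𝓝 t0, ∀ p ∈ postCritical (F t0),
      (IsCriticalValue (F t) (q p t) ↔ IsCriticalValue (F t0) p) := by
    rw [eventually_all_finite hfin]
    intro p hp
    by_cases hV : IsCriticalValue (F t0) p
    · obtain ⟨c, hc, hcp⟩ := id hV
      have h1 := hcont.continuousAt (x := (t0, c)) ((hU p).2.mem_nhds
        (show F t0 c ∈ U p by rw [hcp]; exact (hU p).1))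
      rw [mem_map, mem_nhds_prod_iff] at h1
      obtain ⟨A, hA, B, hB, hAB⟩ := h1
      filter_upwards [crit_persist hcont hT hD hc hB, hA, e0]
      rintro t ⟨x, hxB, hx⟩ htA ht
      have hxv : IsCriticalValue (F t) (F t x) := ⟨x, hx, rfl⟩
      have := huni t ht p hp (F t x) (hAB (mk_mem_prod htA hxB)) (critval_post hxv)
      simp only [hV, iff_true]
      rw [← this]; exact hxv
    · obtain ⟨a, b, hab, hiff⟩ := fib_two (hT t0) (hD t0) p
      have hne : a ≠ b := fun h => hV (hiff.2 h)
      have ha : F t0 a = p := by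
        have : a ∈ F t0 ⁻¹' {p} := by rw [hab]; simp
        exact this
      have hb : F t0 b = p := by
        have : b ∈ F t0 ⁻¹' {p} := by rw [hab]; simp
        exact this
      obtain ⟨N1, N2, o1, o2, m1, m2, hd⟩ := t2_separation hne
      have hlim : Tendsto (fun t => (t, q p t)) (𝓝 t0) (𝓝 (t0, p)) :=
        tendsto_id.prodMk_nhds (hq0c p hp)
      have key : ∀ (z : Sph) (N : Set Sph), F t0 z = p → IsOpen N → z ∈ N →
          ∀ᶠ t in 𝓝 t0, ∃ x ∈ N, F t x = q p t := by
        intro z N hz hN hzN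
        have h1 := hG.op.image_mem_nhds (x := (t0, z)) (prod_mem_nhds univ_mem (hN.mem_nhds hzN))
        simp only [hz] at h1
        filter_upwards [hlim h1]
        rintro t ⟨⟨t', x⟩, ⟨-, hx⟩, he⟩
        simp only [Prod.mk.injEq] at he
        obtain ⟨rfl, he⟩ := he
        exact ⟨x, hx, he⟩
      filter_upwards [key a N1 ha o1 m1, key b N2 hb o2 m2]
      rintro t ⟨x, hx, hxe⟩ ⟨y, hy, hye⟩
      simp only [hV, iff_false]
      rintro ⟨c, hc, hce⟩
      have h1 := crit_unique (hT t) (hD t) hc (hxe.trans hce.symm)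
      have h2 := crit_unique (hT t) (hD t) hc (hye.trans hce.symm)
      exact disjoint_left.1 hd hx (h1.trans h2.symm ▸ hy)
  filter_upwards [hcontq, e0, e1, e2] with t h1 h2 h3 h4
  exact ⟨h1, himg t h2, h3, h4⟩

abbrev E3 := EuclideanSpace ℝ (Fin 3)

theorem exists_sep (P : Finset Sph) : ∃ K : ℝ, 0 ≤ K ∧ ∀ p ∈ P, ∀ p' ∈ P, p ≠ p' →
    1 ≤ K * ‖(p : E3) - p'‖ := by
  let d : Sph × Sph → ℝ := fun z => ‖(z.1 : E3) - z.2‖⁻¹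
  have hd : ∀ z, 0 ≤ d z := fun z => inv_nonneg.2 (norm_nonneg _)
  refine ⟨∑ z ∈ P ×ˢ P, d z, Finset.sum_nonneg fun z _ => hd z, ?_⟩
  intro p hp p' hp' hne
  have h0 : 0 < ‖(p : E3) - p'‖ := by
    rw [norm_pos_iff, sub_ne_zero]
    exact fun h => hne (Subtype.ext h)
  have hm : (p, p') ∈ P ×ˢ P := Finset.mem_product.2 ⟨hp, hp'⟩
  have h1 : d (p, p') ≤ ∑ z ∈ P ×ˢ P, d z := Finset.single_le_sum (fun z _ => hd z) hm
  have h2 : d (p, p') * ‖(p : E3) - p'‖ = 1 := inv_mul_cancel₀ h0.ne'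
  exact h2.symm.le.trans (mul_le_mul_of_nonneg_right h1 h0.le)

def chi (K : ℝ) (p : Sph) (x : E3) : ℝ := max (‖x‖ - K * ‖x - ‖x‖ • (p : E3)‖) 0

theorem sph_norm (p : Sph) : ‖(p : E3)‖ = 1 := by simp

theorem chi_lip {K : ℝ} (hK : 0 ≤ K) (p : Sph) (x y : E3) :
    |chi K p x - chi K p y| ≤ (1 + 2 * K) * ‖x - y‖ := by
  refine (abs_max_sub_max_le_abs _ _ _).trans ?_
  have h1 := abs_norm_sub_norm_le x y
  have h2 : |‖x - ‖x‖ • (p : E3)‖ - ‖y - ‖y‖ • (p : E3)‖| ≤ 2 * ‖x - y‖ := by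
    refine (abs_norm_sub_norm_le _ _).trans ?_
    have : x - ‖x‖ • (p : E3) - (y - ‖y‖ • (p : E3)) = (x - y) - (‖x‖ - ‖y‖) • (p : E3) := by
      rw [sub_smul]; abel
    rw [this]
    refine (norm_sub_le _ _).trans ?_
    rw [norm_smul, sph_norm, mul_one, Real.norm_eq_abs]
    linarith
  have h3 : ‖x‖ - K * ‖x - ‖x‖ • (p : E3)‖ - (‖y‖ - K * ‖y - ‖y‖ • (p : E3)‖)
      = (‖x‖ - ‖y‖) - K * (‖x - ‖x‖ • (p : E3)‖ - ‖y - ‖y‖ • (p : E3)‖) := by ring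
  rw [h3]
  refine (abs_sub _ _).trans ?_
  rw [abs_mul, abs_of_nonneg hK]
  nlinarith

theorem chi_hom (K : ℝ) (p : Sph) (x : E3) {r : ℝ} (hr : 0 ≤ r) :
    chi K p (r • x) = r * chi K p x := by
  unfold chi
  have : r • x - ‖r • x‖ • (p : E3) = r • (x - ‖x‖ • (p : E3)) := by
    rw [norm_smul, Real.norm_eq_abs, abs_of_nonneg hr, smul_sub, mul_smul]
  rw [this, norm_smul, norm_smul, Real.norm_eq_abs, abs_of_nonneg hr, mul_max_of_nonneg _ _ hr,
    mul_zero]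
  congr 1; ring

def push (P : Finset Sph) (K : ℝ) (q : Sph → Sph) (x : E3) : E3 :=
  x + ∑ p ∈ P, chi K p x • ((q p : E3) - p)

theorem push_hom (P : Finset Sph) (K : ℝ) (q : Sph → Sph) (x : E3) {r : ℝ} (hr : 0 ≤ r) :
    push P K q (r • x) = r • push P K q x := by
  simp only [push, smul_add, Finset.smul_sum, chi_hom K _ x hr, mul_smul]

theorem push_lip {P : Finset Sph} {K : ℝ} (hK : 0 ≤ K) {q : Sph → Sph} {ε : ℝ}
    (hq : ∀ p ∈ P, ‖(q p : E3) - p‖ ≤ ε) (x y : E3) :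
    ‖(push P K q x - x) - (push P K q y - y)‖ ≤ (P.card * ((1 + 2 * K) * ε)) * ‖x - y‖ := by
  simp only [push, add_sub_cancel_left, ← Finset.sum_sub_distrib, ← sub_smul]
  refine (norm_sum_le _ _).trans ?_
  rw [mul_assoc, ← nsmul_eq_mul]
  apply Finset.sum_le_card_nsmul
  intro p hp
  rw [norm_smul, Real.norm_eq_abs]
  have h1 := chi_lip hK p x y
  have h2 := hq p hp
  calc _ ≤ ((1 + 2 * K) * ‖x - y‖) * ε := by gcongr
    _ = _ := by ring

theorem push_bij {P : Finset Sph} {K : ℝ} (hK : 0 ≤ K) {q : Sph → Sph} {ε : ℝ}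
    (hq : ∀ p ∈ P, ‖(q p : E3) - p‖ ≤ ε) (hε : P.card * ((1 + 2 * K) * ε) ≤ 1 / 2) :
    Function.Bijective (push P K q) := by
  have key : ∀ x y, ‖(push P K q x - x) - (push P K q y - y)‖ ≤ 1 / 2 * ‖x - y‖ := fun x y =>
    (push_lip hK hq x y).trans (by gcongr)
  constructor
  · intro x y hxy
    have := key x y
    rw [hxy] at this
    have h2 : push P K q y - x - (push P K q y - y) = y - x := by abel
    rw [h2, norm_sub_rev] at this
    have h3 : ‖x - y‖ = 0 := by linarith [norm_nonneg (x - y)]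
    exact sub_eq_zero.1 (norm_eq_zero.1 h3)
  · intro y
    have hc : ContractingWith (1 / 2) fun x => y - (push P K q x - x) := by
      refine ⟨by
        rw [← NNReal.coe_lt_coe]; norm_num, LipschitzWith.of_dist_le_mul fun a b => ?_⟩
      rw [dist_eq_norm, dist_eq_norm]
      have h1 : y - (push P K q a - a) - (y - (push P K q b - b)) =
        -((push P K q a - a) - (push P K q b - b)) := by abel
      rw [h1, norm_neg]
      simpa using key a b
    have h := hc.fixedPoint_isFixedPt
    refine ⟨ContractingWith.fixedPoint _ hc, ?_⟩
    have h2 : y - (push P K q (ContractingWith.fixedPoint _ hc) - ContractingWith.fixedPoint _ hc)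
      = ContractingWith.fixedPoint _ hc := h
    generalize ContractingWith.fixedPoint _ hc = z at h2
    have h3 : y - push P K q z = 0 := by
      have : y - push P K q z = y - (push P K q z - z) - z := by abel
      rw [this, h2, sub_self]
    exact (sub_eq_zero.1 h3).symm

theorem sphere_push (P : Set Sph) (hP : P.Finite) : ∃ ε > 0, ∃ Θ : (Sph → Sph) → Sph → Sph,
    (∀ q : Sph → Sph, (∀ p ∈ P, dist (q p) p < ε) → Function.Bijective (Θ q) ∧
      (∀ p ∈ P, Θ q p = q p)) ∧
    (∀ q : Sph → Sph, (∀ p ∈ P, q p = p) → ∀ x, Θ q x = x) ∧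
    (∀ q : unitInterval → Sph → Sph, (∀ p ∈ P, Continuous fun t => q t p) →
      (∀ t, ∀ p ∈ P, dist (q t p) p < ε) →
      Continuous fun z : unitInterval × Sph => Θ (q z.1) z.2) := by
  classical
  lift P to Finset Sph using hP
  simp only [Finset.mem_coe]
  obtain ⟨K, hK, hsep⟩ := exists_sep P
  let ε : ℝ := 1 / (2 * (P.card + 1) * (1 + 2 * K))
  have hε : 0 < ε := by positivity
  have hε2 : P.card * ((1 + 2 * K) * ε) ≤ 1 / 2 := by
    have : P.card * ((1 + 2 * K) * ε) = P.card / (P.card + 1) * (1 / 2) := by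
      simp only [ε]; field_simp
    rw [this]
    have h1 : (P.card : ℝ) / (P.card + 1) ≤ 1 := by
      rw [div_le_one (by positivity)]; linarith
    linarith
  let x0 : Sph := Classical.arbitrary Sph
  let Θ : (Sph → Sph) → Sph → Sph := fun q x =>
    if h : push P K q x = 0 then x0 else
      ⟨‖push P K q x‖⁻¹ • push P K q x, by
        rw [mem_sphere_zero_iff_norm, norm_smul, norm_inv, norm_norm,
          inv_mul_cancel₀ (norm_ne_zero_iff.2 h)]⟩
  have hΘ : ∀ q (x : Sph), push P K q (x : E3) ≠ 0 → (Θ q x : E3) = ‖push P K q x‖⁻¹ • push P K q x := by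
    intro q x h
    simp only [Θ, h, dite_false]
  have hp0 : ∀ q, push P K q 0 = 0 := fun q => by
    have := push_hom P K q 0 (le_refl 0)
    simpa using this
  have hgood : ∀ q : Sph → Sph, (∀ p ∈ P, dist (q p) p < ε) → Function.Bijective (push P K q) := by
    intro q hq
    refine push_bij hK (ε := ε) (fun p hp => ?_) hε2
    have := (hq p hp).le
    rwa [Subtype.dist_eq, dist_eq_norm] at this
  have hne : ∀ q : Sph → Sph, (∀ p ∈ P, dist (q p) p < ε) → ∀ x : E3, x ≠ 0 → push P K q x ≠ 0 := by
    intro q hq x hx h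
    exact hx ((hgood q hq).1 (h.trans (hp0 q).symm))
  have hs0 : ∀ x : Sph, (x : E3) ≠ 0 := fun x h => by
    have := sph_norm x
    rw [h] at this; simp at this
  refine ⟨ε, hε, Θ, fun q hq => ⟨⟨?_, ?_⟩, ?_⟩, ?_, ?_⟩
  · intro x y hxy
    have h1 := congrArg Subtype.val hxy
    rw [hΘ q x (hne q hq x (hs0 x)), hΘ q y (hne q hq y (hs0 y)), ← push_hom _ _ _ _ (by positivity),
      ← push_hom _ _ _ _ (by positivity)] at h1
    have h2 := (hgood q hq).1 h1
    have h3 := congrArg norm h2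
    rw [norm_smul, norm_smul, sph_norm, sph_norm, norm_inv, norm_inv, norm_norm, norm_norm, mul_one,
      mul_one] at h3
    rw [h3] at h2
    have h4 : ‖push P K q (y : E3)‖⁻¹ ≠ 0 :=
      inv_ne_zero (norm_ne_zero_iff.2 (hne q hq y (hs0 y)))
    exact Subtype.ext (smul_right_injective E3 h4 h2)
  · intro y
    obtain ⟨x, hx⟩ := (hgood q hq).2 (y : E3)
    have hx0 : x ≠ 0 := by
      rintro rfl
      rw [hp0] at hx
      exact hs0 y hx.symm
    have hn : ‖x‖ ≠ 0 := norm_ne_zero_iff.2 hx0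
    let x' : Sph := ⟨‖x‖⁻¹ • x, by
      rw [mem_sphere_zero_iff_norm, norm_smul, norm_inv, norm_norm, inv_mul_cancel₀ hn]⟩
    refine ⟨x', Subtype.ext ?_⟩
    rw [hΘ q x' (hne q hq x' (hs0 x'))]
    have h1 : push P K q (x' : E3) = ‖x‖⁻¹ • (y : E3) := by
      rw [← hx]; exact push_hom _ _ _ _ (by positivity)
    rw [h1, norm_smul, sph_norm, mul_one, norm_inv, norm_norm, inv_inv, smul_smul,
      mul_inv_cancel₀ hn, one_smul]
  · intro p hp
    have h1 : push P K q (p : E3) = q p := by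
      unfold push
      rw [Finset.sum_eq_single p]
      · have : chi K p (p : E3) = 1 := by
          unfold chi
          rw [sph_norm, one_smul, sub_self]; simp
        rw [this, one_smul]; abel
      · intro p' hp' hne'
        have : chi K p' (p : E3) = 0 := by
          unfold chi
          rw [sph_norm, one_smul]
          apply max_eq_right
          linarith [hsep p hp p' hp' hne'.symm]
        rw [this, zero_smul]
      · exact fun h => absurd hp h
    apply Subtype.ext
    rw [hΘ q p (by rw [h1]; exact hs0 _), h1, sph_norm, inv_one, one_smul]
  · intro q hq x
    have h1 : push P K q (x : E3) = x := by
      unfold push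
      rw [Finset.sum_eq_zero, add_zero]
      intro p hp
      rw [hq p hp, sub_self, smul_zero]
    apply Subtype.ext
    rw [hΘ q x (by rw [h1]; exact hs0 _), h1, sph_norm, inv_one, one_smul]
  · intro q hqc hq
    rw [Topology.IsInducing.subtypeVal.continuous_iff]
    have h1 : (Subtype.val ∘ fun z : unitInterval × Sph => Θ (q z.1) z.2) = fun z =>
        ‖push P K (q z.1) z.2‖⁻¹ • push P K (q z.1) z.2 := by
      funext z
      exact hΘ _ _ (hne _ (hq z.1) _ (hs0 z.2))
    have h2 : Continuous fun z : unitInterval × Sph => push P K (q z.1) z.2 := by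
      unfold push
      apply Continuous.add (by fun_prop)
      apply continuous_finset_sum
      intro p hp
      have h3 : Continuous fun z : unitInterval × Sph => q z.1 p := (hqc p hp).comp continuous_fst
      refine Continuous.smul (f := fun z : unitInterval × Sph => chi K p z.2)
        (g := fun z => (q z.1 p : E3) - p) ?_ ?_
      · unfold chi; fun_prop
      · fun_prop
    rw [h1]
    exact (h2.norm.inv₀ fun z => norm_ne_zero_iff.2 (hne _ (hq z.1) _ (hs0 z.2))).smul h2

def TE (F G : Sph → Sph) : Prop :=
  ∃ (φ ψ : Sph ≃ₜ Sph) (H : unitInterval × Sph → Sph), (∀ x, φ (F x) = G (ψ x)) ∧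
    Continuous H ∧ (∀ x, H (0, x) = φ x) ∧ (∀ x, H (1, x) = ψ x) ∧
    (∀ s, ∀ p ∈ postCritical F, H (s, p) = φ p) ∧ φ '' postCritical F = postCritical G

theorem TE.equiv {F G : Sph → Sph} (h : TE F G) : ThurstonEquiv F G := by
  obtain ⟨φ, ψ, H, h1, h2, h3, h4, h5, -⟩ := h
  refine ⟨φ, ψ, h1, ⟨⟨⟨⟨H, h2⟩, h3, h4⟩, ?_⟩⟩⟩
  intro s p hp
  exact h5 s p hp

theorem TE.trans {F G K : Sph → Sph} (h : TE F G) (h' : TE G K) : TE F K := by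
  obtain ⟨φ, ψ, H, h1, h2, h3, h4, h5, h6⟩ := h
  obtain ⟨φ', ψ', H', h1', h2', h3', h4', h5', h6'⟩ := h'
  refine ⟨φ.trans φ', ψ.trans ψ', fun z => H' (z.1, H z), ?_, ?_, ?_, ?_, ?_, ?_⟩
  · intro x; simp [h1, h1']
  · fun_prop
  · intro x; simp [h3, h3']
  · intro x; simp [h4, h4']
  · intro s p hp
    simp only [h5 s p hp, Homeomorph.trans_apply]
    apply h5'
    rw [← h6]; exact mem_image_of_mem _ hp
  · rw [← h6', ← h6, ← image_comp]; rfl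

theorem TE.symm {F G : Sph → Sph} (h : TE F G) : TE G F := by
  obtain ⟨φ, ψ, H, h1, h2, h3, h4, h5, h6⟩ := h
  refine ⟨φ.symm, ψ.symm, fun z => φ.symm (H (unitInterval.symm z.1, ψ.symm z.2)),
    ?_, ?_, ?_, ?_, ?_, ?_⟩
  · intro x
    rw [φ.symm_apply_eq, h1]; simp
  · fun_prop
  · intro x; simp [h4]
  · intro x; simp [h3]
  · intro s y hy
    rw [← h6] at hy
    obtain ⟨p, hp, rfl⟩ := hy
    have : ψ.symm (φ p) = p := by
      rw [ψ.symm_apply_eq, ← h4, h5 1 p hp]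
    simp only [this, h5 _ p hp]
  · rw [← h6, ← image_comp]; simp

theorem homeo_of {f : Sph → Sph} (hc : Continuous f) (hb : Function.Bijective f) :
    ∃ h : Sph ≃ₜ Sph, ∀ x, h x = f x :=
  ⟨Continuous.homeoOfEquivCompactToT2 (f := Equiv.ofBijective f hb) hc, fun _ => rfl⟩

theorem inv_family {φ : unitInterval × Sph → Sph} (hc : Continuous φ)
    (hb : ∀ s, Function.Bijective fun x => φ (s, x)) :
    ∃ φi : unitInterval × Sph → Sph, Continuous φi ∧ (∀ s x, φi (s, φ (s, x)) = x) ∧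
      ∀ s x, φ (s, φi (s, x)) = x := by
  let Ψ : unitInterval × Sph → unitInterval × Sph := fun z => (z.1, φ z)
  have hΨb : Function.Bijective Ψ := by
    constructor
    · rintro ⟨s, x⟩ ⟨s', x'⟩ h
      simp only [Ψ, Prod.mk.injEq] at h
      obtain ⟨rfl, h⟩ := h
      rw [(hb s).1 h]
    · rintro ⟨s, y⟩
      obtain ⟨x, hx⟩ := (hb s).2 y
      exact ⟨(s, x), Prod.ext rfl hx⟩
  have hΨc : Continuous Ψ := by fun_prop
  let e : unitInterval × Sph ≃ₜ unitInterval × Sph :=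
    Continuous.homeoOfEquivCompactToT2 (f := Equiv.ofBijective Ψ hΨb) hΨc
  have he : ∀ z, e z = (z.1, φ z) := fun z => rfl
  refine ⟨fun z => (e.symm z).2, by fun_prop, ?_, ?_⟩
  · intro s x
    have : e.symm (s, φ (s, x)) = (s, x) := by rw [e.symm_apply_eq, he]
    simp only [this]
  · intro s x
    have h1 := e.apply_symm_apply (s, x)
    rw [he] at h1
    have h2 := congrArg Prod.fst h1
    have h3 := congrArg Prod.snd h1
    simp only at h2 h3
    have h4 : (s, (e.symm (s, x)).2) = e.symm (s, x) := Prod.ext h2.symm rfl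
    simp only [h4, h3]

theorem TE_local {F : unitInterval → Sph → Sph}
    (hcont : Continuous fun p : unitInterval × Sph => F p.1 p.2)
    (hT : ∀ t, IsThurstonMap (F t))
    (hD : ∀ t, HasDegreeTwo (F t))
    (hcard : ∀ t t' : unitInterval,
      Nat.card (postCritical (F t)) = Nat.card (postCritical (F t'))) (t0 : unitInterval) :
    ∀ᶠ t1 in 𝓝 t0, TE (F t0) (F t1) := by
  obtain ⟨q, hq0, hq⟩ := local_motion hcont hT hD hcard t0
  obtain ⟨ε, hε, Θ, hΘ1, hΘ2, hΘ3⟩ := sphere_push _ (hT t0).2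
  have hnear : ∀ᶠ t in 𝓝 t0, ∀ p ∈ postCritical (F t0), dist (q p t) p < ε := by
    rw [eventually_all_finite (hT t0).2]
    intro p hp
    have h1 := hq.self_of_nhds.1 p hp
    unfold ContinuousAt at h1
    rw [hq0 p hp] at h1
    exact h1 (Metric.ball_mem_nhds p hε)
  obtain ⟨δ, hδ, hgood⟩ := Metric.eventually_nhds_iff.1 (hq.and hnear)
  filter_upwards [Metric.ball_mem_nhds t0 hδ] with t1 ht1
  -- the straight path
  have hγm : ∀ s : unitInterval, (t0 : ℝ) + s * ((t1 : ℝ) - t0) ∈ unitInterval := fun s => by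
    obtain ⟨a0, a1⟩ := t0.2
    obtain ⟨b0, b1⟩ := t1.2
    obtain ⟨s0, s1⟩ := s.2
    constructor <;> nlinarith
  let γ : unitInterval → unitInterval := fun s => ⟨(t0 : ℝ) + s * ((t1 : ℝ) - t0), hγm s⟩
  have hγc : Continuous γ := by
    refine Continuous.subtype_mk ?_ _
    fun_prop
  have hγ0 : γ 0 = t0 := Subtype.ext (by simp [γ])
  have hγ1 : γ 1 = t1 := Subtype.ext (by simp [γ])
  have hγd : ∀ s, dist (γ s) t0 < δ := fun s => by
    refine lt_of_le_of_lt ?_ (Metric.mem_ball.1 ht1)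
    rw [Subtype.dist_eq, Subtype.dist_eq, Real.dist_eq, Real.dist_eq]
    have : ((γ s : unitInterval) : ℝ) - t0 = s * ((t1 : ℝ) - t0) := by simp [γ]
    rw [this, abs_mul, abs_of_nonneg s.2.1]
    exact mul_le_of_le_one_left (abs_nonneg _) s.2.2
  have hg := fun s => hgood (hγd s)
  let φ : unitInterval × Sph → Sph := fun z => Θ (fun p => q p (γ z.1)) z.2
  have hφc : Continuous φ := by
    apply hΘ3 (fun s p => q p (γ s))
    · intro p hp
      rw [continuous_iff_continuousAt]
      intro s
      exact ContinuousAt.comp (x := s) ((hg s).1.1 p hp) hγc.continuousAt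
    · exact fun s => (hg s).2
  have hφb : ∀ s, Function.Bijective fun x => φ (s, x) := fun s => (hΘ1 _ (hg s).2).1
  have hφP : ∀ s, ∀ p ∈ postCritical (F t0), φ (s, p) = q p (γ s) := fun s =>
    (hΘ1 _ (hg s).2).2
  have hφ0 : ∀ x, φ (0, x) = x := by
    refine hΘ2 (fun p => q p (γ 0)) ?_
    intro p hp
    simp only [hγ0]; exact hq0 p hp
  obtain ⟨φi, hφic, hφi1, hφi2⟩ := inv_family hφc hφb
  have hφi0 : ∀ x, φi (0, x) = x := fun x => by
    have := hφi1 0 x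
    rwa [hφ0] at this
  let G : unitInterval → Sph → Sph := fun s x => φi (s, F (γ s) x)
  have hGp : ∀ s y, G s ⁻¹' {y} = F (γ s) ⁻¹' {φ (s, y)} := by
    intro s y
    ext x
    simp only [G, mem_preimage, mem_singleton_iff]
    constructor
    · rintro rfl; rw [hφi2]
    · intro h; rw [h, hφi1]
  have hcγ : Continuous fun p : unitInterval × Sph => F (γ p.1) p.2 :=
    hcont.comp ((hγc.comp continuous_fst).prodMk continuous_snd)
  have hGc : Continuous fun p : unitInterval × Sph => G p.1 p.2 := by
    simp only [G]; fun_prop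
  have hGfib : ∀ t y, ∃ x x', G t ⁻¹' {y} = {x, x'} := by
    intro s y
    rw [hGp]
    obtain ⟨a, b, h, -⟩ := fib_two (hT (γ s)) (hD (γ s)) (φ (s, y))
    exact ⟨a, b, h⟩
  have hG : DegTwoFam G := by
    refine ⟨hGc, open_family hGc ?_ ?_, hGfib⟩
    · intro s
      have h1 : IsOpenMap fun x => φi (s, x) :=
        IsOpenMap.of_inverse (f' := fun x => φ (s, x)) (by fun_prop) (fun x => hφi1 s x)
          (fun x => hφi2 s x)
      exact h1.comp (ram_open (hT (γ s)).1)
    · intro s y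
      obtain ⟨a, b, h⟩ := hGfib s y
      rw [h]; exact toFinite _
  obtain ⟨ψ, hψc, hψ0, hψb, hψG, hψp⟩ := lift_family G hG {y | IsCriticalValue (F t0) y}
    (critval_finite (hT t0) (hD t0)).isClosed (by
      intro s y
      rw [hGp, ← critval_iff (hT (γ s)) (hD (γ s))]
      show IsCriticalValue (F t0) y ↔ _
      by_cases hy : y ∈ postCritical (F t0)
      · rw [hφP s y hy]
        exact ((hg s).1.2.2.2 y hy).symm
      · constructor
        · exact fun h => absurd (critval_post h) hy
        · intro h
          have h1 := critval_post h
          rw [← (hg s).1.2.1] at h1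
          obtain ⟨p, hp, hpe⟩ := h1
          have h2 : φ (s, p) = φ (s, y) := (hφP s p hp).trans hpe
          have h3 := (hφb s).1 h2
          exact absurd (h3 ▸ hp) hy)
  have hG0 : ∀ x, G 0 x = F t0 x := fun x => by simp only [G, hφi0, hγ0]
  have hψF : ∀ s x, F (γ s) (ψ (s, x)) = φ (s, F t0 x) := fun s x => by
    have := hψG s x
    rw [hG0] at this
    rw [← this, hφi2]
  have hψP : ∀ s, ∀ p ∈ postCritical (F t0), ψ (s, p) = φ (s, p) := by
    intro s p hp
    have h1 : ∀ s, G s (q p (γ s)) = F t0 p := fun s => by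
      simp only [G]
      rw [(hg s).1.2.2.1 p hp, ← hφP s _ (post_inv hp), hφi1]
    have h2 := hψp (fun s => q p (γ s)) (by
      have : (fun s => q p (γ s)) = fun s => φ (s, p) := funext fun s => (hφP s p hp).symm
      rw [this]; fun_prop) (fun s => by rw [h1, h1]) s
    simp only [hγ0, hq0 p hp] at h2
    rw [h2, hφP s p hp]
  obtain ⟨φ1, hφ1⟩ := homeo_of (f := fun x => φ (1, x)) (by fun_prop) (hφb 1)
  obtain ⟨ψ1, hψ1⟩ := homeo_of (f := fun x => ψ (1, x)) (by fun_prop) (hψb 1)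
  refine ⟨φ1, ψ1, fun z => φ (1, φi (z.1, ψ z)), ?_, by fun_prop, ?_, ?_, ?_, ?_⟩
  · intro x
    rw [hφ1, hψ1, ← hψF, hγ1]
  · intro x
    simp only [hψ0, hφi0, hφ1]
  · intro x
    simp only [hφi2, hψ1]
  · intro s p hp
    simp only [hψP s p hp, hφi1, hφ1]
  · rw [← hγ1, ← (hg 1).1.2.1]
    apply image_congr
    intro p hp
    rw [hφ1, hφP 1 p hp]
/-- If `F_t`, `t ∈ [0,1]`, is a continuous family of Thurston maps of
degree 2 with post-critical sets of constant cardinality, then `F₀` is Thurston equivalent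
to `F₁`. -/
theorem thurston_equiv_of_continuous_family (F : unitInterval → Sph → Sph)
    (hcont : Continuous fun p : unitInterval × Sph => F p.1 p.2)
    (hthurston : ∀ t, IsThurstonMap (F t))
    (hdeg : ∀ t, HasDegreeTwo (F t))
    (hcard : ∀ t t' : unitInterval,
      Nat.card (postCritical (F t)) = Nat.card (postCritical (F t'))) :
    ThurstonEquiv (F 0) (F 1) := by

  have h := isPreconnected_univ (α := unitInterval)
  refine TE.equiv (h.induction₂ (fun s t => TE (F s) (F t)) ?_ ?_ ?_ (mem_univ 0) (mem_univ 1))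
  · intro t _
    rw [nhdsWithin_univ]
    exact TE_local hcont hthurston hdeg hcard t
  · intro a b c _ _ _ h1 h2
    exact h1.trans h2
  · intro a b _ _ h1
    exact h1.symm
end
end
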